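/- arXiv:2203.00434 — 2 statements merged into one kernel-verified Lean document; each statement's English description precedes it below -/
import Mathlib

section
/- Let X ⊆ A^{ℤ²} and Y ⊆ B^{ℤ²} be nonempty two-dimensional subshifts over finite alphabets and let m, n be positive integers such that X is an (m,n)-th root of Y. Then h(Y) = m·n·h(X). -/
open Filter

/-- Shift on one-dimensional configurations: `(shift1 p x) k = x (k - p)`. -/
def shift1 {A : Type*} (p : ℤ) (x : ℤ → A) : ℤ → A := fun k => x (k - p)

/-- Shift on two-dimensional configurations: `(shift2 v x) k = x (k - v)`. -/
def shift2 {A : Type*} (v : ℤ × ℤ) (x : ℤ × ℤ → A) : ℤ × ℤ → A := fun k => x (k - v)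

/-- The finite word `w` occurs in the bi-infinite sequence `x`. -/
def occursIn1 {A : Type*} (w : List A) (x : ℤ → A) : Prop :=
  ∃ i : ℤ, ∀ (n : ℕ) (h : n < w.length), x (i + n) = w.get ⟨n, h⟩

/-- The one-dimensional SFT avoiding the finite set `F` of forbidden words. -/
def SFT1 {A : Type*} (F : Finset (List A)) : Set (ℤ → A) :=
  {x | ∀ w ∈ F, ¬ occursIn1 w x}

/-- `H` is a one-dimensional subshift of finite type. -/
def IsSFT1 {A : Type*} (H : Set (ℤ → A)) : Prop :=
  ∃ F : Finset (List A), H = SFT1 F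

/-- A finite two-dimensional pattern: a finite support together with values. -/
structure Pattern2 (A : Type*) where
  support : Finset (ℤ × ℤ)
  val : ℤ × ℤ → A

/-- The pattern `p` occurs in the configuration `x`. -/
def Pattern2.OccursIn {A : Type*} (p : Pattern2 A) (x : ℤ × ℤ → A) : Prop :=
  ∃ v : ℤ × ℤ, ∀ u ∈ p.support, x (u + v) = p.val u

/-- The two-dimensional SFT avoiding the finite set `F` of forbidden patterns. -/
def SFT2 {A : Type*} (F : Finset (Pattern2 A)) : Set (ℤ × ℤ → A) :=
  {x | ∀ p ∈ F, ¬ p.OccursIn x}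

/-- The SFT `X_F` with added horizontal constraints from `H`: every row lies in `H`
and no pattern of `F` occurs. -/
def XHF {A : Type*} (H : Set (ℤ → A)) (F : Finset (Pattern2 A)) : Set (ℤ × ℤ → A) :=
  {x | (∀ j : ℤ, (fun k => x (k, j)) ∈ H) ∧ ∀ p ∈ F, ¬ p.OccursIn x}

/-- The combined subshift: rows in `H`, columns in `V`. -/
def XHV {A : Type*} (H V : Set (ℤ → A)) : Set (ℤ × ℤ → A) :=
  {x | (∀ j : ℤ, (fun k => x (k, j)) ∈ H) ∧ ∀ i : ℤ, (fun l => x (i, l)) ∈ V}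

/-- Number of restrictions of elements of `X` to `[0,m) × [0,n)`. -/
noncomputable def patCount2 {A : Type*} (X : Set (ℤ × ℤ → A)) (m n : ℕ) : ℕ :=
  Set.ncard {p : Fin m → Fin n → A |
    ∃ x ∈ X, ∀ (i : Fin m) (j : Fin n), x ((i : ℤ), (j : ℤ)) = p i j}

/-- Topological entropy of a two-dimensional subshift. -/
noncomputable def entropy2 {A : Type*} (X : Set (ℤ × ℤ → A)) : ℝ :=
  ⨅ n : ℕ, Real.logb 2 (patCount2 X (n + 1) (n + 1)) / ((n : ℝ) + 1) ^ 2

/-- The word `w` belongs to the language of `H`. -/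
def wordIn {A : Type*} (H : Set (ℤ → A)) (w : List A) : Prop :=
  ∃ x ∈ H, occursIn1 w x

/-- Number of length-`n` words in the language of `H`. -/
noncomputable def wordCount {A : Type*} (H : Set (ℤ → A)) (n : ℕ) : ℕ :=
  Set.ncard {w : List A | w.length = n ∧ wordIn H w}

/-- Topological entropy of a one-dimensional subshift. -/
noncomputable def entropy1 {A : Type*} (H : Set (ℤ → A)) : ℝ :=
  ⨅ n : ℕ, Real.logb 2 (wordCount H (n + 1)) / ((n : ℝ) + 1)

/-- `X` is a two-dimensional subshift (closed and shift-invariant). -/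
def IsSubshift2 {A : Type*} [TopologicalSpace A] (X : Set (ℤ × ℤ → A)) : Prop :=
  IsClosed X ∧ ∀ (v : ℤ × ℤ) (x : ℤ × ℤ → A), x ∈ X → shift2 v x ∈ X

/-- `X` is an `(m,n)`-th root of `Y`. -/
def IsRoot {A B : Type*} [TopologicalSpace A] [TopologicalSpace B]
    (X : Set (ℤ × ℤ → A)) (Y : Set (ℤ × ℤ → B)) (m n : ℕ) : Prop :=
  ∃ Z : Set (ℤ × ℤ → A), Z ⊆ X ∧ IsClopen {x : X | (x : ℤ × ℤ → A) ∈ Z} ∧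
    shift2 ((m : ℤ), 0) '' Z = Z ∧ shift2 (0, (n : ℤ)) '' Z = Z ∧
    (∃ φ : Z ≃ₜ Y,
      ∀ (x : Z) (k₁ k₂ : ℤ)
        (hx : shift2 (k₁ * (m : ℤ), k₂ * (n : ℤ)) (x : ℤ × ℤ → A) ∈ Z),
        (φ ⟨shift2 (k₁ * (m : ℤ), k₂ * (n : ℤ)) (x : ℤ × ℤ → A), hx⟩ : ℤ × ℤ → B) =
          shift2 (k₁, k₂) (φ x : ℤ × ℤ → B)) ∧
    (∀ i j : ℕ, i < m → j < n → shift2 ((i : ℤ), (j : ℤ)) '' Z ⊆ X) ∧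
    ∀ x ∈ X, ∃! q : Fin m × Fin n, x ∈ shift2 ((q.1 : ℤ), (q.2 : ℤ)) '' Z

/-- The vertex shift (nearest-neighbor SFT) of a directed graph on `A`. -/
def vertexShift {A : Type*} (E : A → A → Prop) : Set (ℤ → A) :=
  {x | ∀ i : ℤ, E (x i) (x (i + 1))}

/-- Strongly connected component: a maximal nonempty set whose vertices are pairwise
joined by nonempty directed paths. -/
def IsSCC {A : Type*} (E : A → A → Prop) (S : Set A) : Prop :=
  S.Nonempty ∧ (∀ a ∈ S, ∀ b ∈ S, Relation.TransGen E a b) ∧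
    ∀ T : Set A, S ⊆ T → (∀ a ∈ T, ∀ b ∈ T, Relation.TransGen E a b) → T = S

def ReflexiveType {A : Type*} (E : A → A → Prop) (S : Set A) : Prop :=
  ∀ v ∈ S, E v v

def SymmetricType {A : Type*} (E : A → A → Prop) (S : Set A) : Prop :=
  ∀ v ∈ S, ∀ w ∈ S, v ≠ w → E v w → E w v

def StateSplitType {A : Type*} (E : A → A → Prop) (S : Set A) : Prop :=
  ∃ p : ℕ, 0 < p ∧ ∃ f : A → ZMod p,
    (∀ i : ZMod p, ∃ v ∈ S, f v = i) ∧
    ∀ v ∈ S, ∀ w ∈ S, (E v w ↔ f w = f v + 1)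

/-- Condition D: all SCCs share one of the three types. -/
def ConditionD {A : Type*} (E : A → A → Prop) : Prop :=
  (∀ S : Set A, IsSCC E S → ReflexiveType E S) ∨
  (∀ S : Set A, IsSCC E S → SymmetricType E S) ∨
  (∀ S : Set A, IsSCC E S → StateSplitType E S)

/-- A real is Π₁-computable (right-recursively enumerable). -/
def Pi1Computable (x : ℝ) : Prop :=
  ∃ f : ℕ → ℚ, Computable f ∧ Antitone f ∧
    Tendsto (fun n => (f n : ℝ)) atTop (nhds x)

/-- A computable real number. -/
def IsComputableReal (x : ℝ) : Prop :=
  ∃ f : ℕ → ℚ, Computable f ∧ ∀ n : ℕ, |(f n : ℝ) - x| ≤ (2 : ℝ) ^ (-(n : ℤ))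

/-- `w` is a finite concatenation of copies of `w₁` and `w₂`. -/
def IsConcat {A : Type*} (w₁ w₂ w : List A) : Prop :=
  ∃ L : List (List A), (∀ v ∈ L, v = w₁ ∨ v = w₂) ∧ w = L.flatten

/-- Transitivity of a one-dimensional subshift. -/
def Transitive1 {A : Type*} (H : Set (ℤ → A)) : Prop :=
  ∀ u w : List A, wordIn H u → wordIn H w → ∃ v : List A, wordIn H (u ++ v ++ w)

/-- The subshift of elements of `H` avoiding the word `u`. -/
def avoidWord {A : Type*} (H : Set (ℤ → A)) (u : List A) : Set (ℤ → A) :=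
  {x ∈ H | ¬ occursIn1 u x}

open Set in
/-- If the observables `g i` jointly determine `f`, then `f` takes at most as many values as the
product of the numbers of values of the `g i`. -/
theorem ncard_range_le_prod {α β ι : Type*} {γ : ι → Type*} [Fintype ι] [∀ i, Finite (γ i)]
    (f : α → β) (g : ∀ i, α → γ i) (h : ∀ x y, (∀ i, g i x = g i y) → f x = f y) :
    (range f).ncard ≤ ∏ i, (range (g i)).ncard := by
  let e : range f → ∀ i, range (g i) := fun b i => ⟨g i b.2.choose, mem_range_self _⟩
  have he : Function.Injective e := by
    intro b c hbc
    apply Subtype.ext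
    rw [← b.2.choose_spec, ← c.2.choose_spec]
    exact h _ _ fun i => congrArg Subtype.val (congrFun hbc i)
  have := Nat.card_le_card_of_injective e he
  rwa [Nat.card_pi] at this

open Set in
theorem ncard_range_le_mul {α β γ δ : Type*} [Finite γ] [Finite δ]
    (f : α → β) (g : α → γ) (k : α → δ) (h : ∀ x y, g x = g y → k x = k y → f x = f y) :
    (range f).ncard ≤ (range g).ncard * (range k).ncard := by
  let e : range f → range g × range k :=
    fun b => (⟨g b.2.choose, mem_range_self _⟩, ⟨k b.2.choose, mem_range_self _⟩)
  have he : Function.Injective e := by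
    intro b c hbc
    apply Subtype.ext
    rw [← b.2.choose_spec, ← c.2.choose_spec]
    exact h _ _ (congrArg (fun q => q.1.1) hbc) (congrArg (fun q => q.2.1) hbc)
  have := Nat.card_le_card_of_injective e he
  rwa [Nat.card_prod] at this

open Set in
theorem ncard_range_le_of_determined {α β γ : Type*} [Finite γ]
    (f : α → β) (g : α → γ) (h : ∀ x y, g x = g y → f x = f y) :
    (range f).ncard ≤ (range g).ncard := by
  simpa using ncard_range_le_prod (ι := Unit) (γ := fun _ => γ) f (fun _ => g)
    fun x y hxy => h x y (hxy ())

theorem shift2_shift2 {A : Type*} (v w : ℤ × ℤ) (x : ℤ × ℤ → A) :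
    shift2 v (shift2 w x) = shift2 (v + w) x := by
  funext k
  simp only [shift2]
  congr 1
  abel

theorem shift2_zero {A : Type*} (x : ℤ × ℤ → A) : shift2 0 x = x := by
  funext k
  simp [shift2]

/-- The pattern of `x` on the `M × N` rectangle with lower-left corner `v`. -/
def rectPattern {A : Type*} (M N : ℕ) (v : ℤ × ℤ) (x : ℤ × ℤ → A) : Fin M → Fin N → A :=
  fun i j => x ((i : ℤ) + v.1, (j : ℤ) + v.2)

theorem rectPattern_eq_iff {A : Type*} {M N : ℕ} {v : ℤ × ℤ} {x y : ℤ × ℤ → A} :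
    rectPattern M N v x = rectPattern M N v y ↔
      ∀ a b : ℤ, v.1 ≤ a → a < v.1 + M → v.2 ≤ b → b < v.2 + N → x (a, b) = y (a, b) := by
  constructor
  · intro h a b h1 h2 h3 h4
    have := congrFun (congrFun h ⟨(a - v.1).toNat, by omega⟩) ⟨(b - v.2).toNat, by omega⟩
    simp only [rectPattern] at this
    have e1 : (((a - v.1).toNat : ℕ) : ℤ) + v.1 = a := by omega
    have e2 : (((b - v.2).toNat : ℕ) : ℤ) + v.2 = b := by omega
    rwa [e1, e2] at this
  · intro h
    funext i j
    have := i.2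
    have := j.2
    exact h _ _ (by omega) (by omega) (by omega) (by omega)

theorem patCount2_eq_ncard_range {A : Type*} (X : Set (ℤ × ℤ → A)) (M N : ℕ) :
    patCount2 X M N = (Set.range fun x : X => rectPattern M N 0 (x : ℤ × ℤ → A)).ncard := by
  unfold patCount2
  congr 1
  ext p
  simp only [Set.mem_ofPred_eq, Set.mem_range, Subtype.exists, rectPattern, funext_iff]
  simp

theorem ncard_range_rectPattern_le {A : Type*} [Finite A] {X : Set (ℤ × ℤ → A)}
    (hX : ∀ (v : ℤ × ℤ) (x : ℤ × ℤ → A), x ∈ X → shift2 v x ∈ X) (M N : ℕ) (v : ℤ × ℤ) :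
    (Set.range fun x : X => rectPattern M N v (x : ℤ × ℤ → A)).ncard ≤ patCount2 X M N := by
  rw [patCount2_eq_ncard_range]
  refine Set.ncard_le_ncard ?_ (Set.toFinite _)
  rintro _ ⟨x, rfl⟩
  refine ⟨⟨shift2 (-v) x, hX _ _ x.2⟩, ?_⟩
  funext i j
  simp only [rectPattern, shift2]
  exact congrArg _ (Prod.ext (by simp) (by simp))

theorem patCount2_pos {A : Type*} [Finite A] {X : Set (ℤ × ℤ → A)} (hne : X.Nonempty) (M N : ℕ) :
    0 < patCount2 X M N := by
  rw [patCount2_eq_ncard_range, Set.ncard_pos]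
  have := hne.to_subtype
  exact Set.range_nonempty _

theorem patCount2_mono {A : Type*} [Finite A] (X : Set (ℤ × ℤ → A)) {M N M' N' : ℕ}
    (hM : M ≤ M') (hN : N ≤ N') : patCount2 X M N ≤ patCount2 X M' N' := by
  rw [patCount2_eq_ncard_range, patCount2_eq_ncard_range]
  apply ncard_range_le_of_determined
  intro x y h
  rw [rectPattern_eq_iff] at h ⊢
  intro a b h1 h2 h3 h4
  exact h a b h1 (by omega) h3 (by omega)

theorem patCount2_mul_le_pow {A : Type*} [Finite A] {X : Set (ℤ × ℤ → A)}
    (hX : ∀ (v : ℤ × ℤ) (x : ℤ × ℤ → A), x ∈ X → shift2 v x ∈ X) (a b M N : ℕ) :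
    patCount2 X (a * M) (b * N) ≤ patCount2 X M N ^ (a * b) := by
  rw [patCount2_eq_ncard_range]
  calc _ ≤ ∏ q : Fin a × Fin b, (Set.range fun x : X =>
          rectPattern M N ((q.1 * M : ℤ), (q.2 * N : ℤ)) (x : ℤ × ℤ → A)).ncard := by
        apply ncard_range_le_prod
        intro x y h
        funext i j
        have hM : 0 < M := Nat.pos_of_ne_zero fun h0 => by have := i.2; simp [h0] at this
        have hN : 0 < N := Nat.pos_of_ne_zero fun h0 => by have := j.2; simp [h0] at this
        have hi := Nat.mod_add_div (i : ℕ) M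
        have hj := Nat.mod_add_div (j : ℕ) N
        have := congrFun (congrFun (h (⟨i / M, Nat.div_lt_of_lt_mul (i.2.trans_eq (mul_comm _ _))⟩,
          ⟨j / N, Nat.div_lt_of_lt_mul (j.2.trans_eq (mul_comm _ _))⟩))
          ⟨i % M, Nat.mod_lt _ hM⟩) ⟨j % N, Nat.mod_lt _ hN⟩
        simp only [rectPattern] at this ⊢
        have e1 : (((i : ℕ) % M : ℕ) : ℤ) + (((i : ℕ) / M : ℕ) : ℤ) * M = (i : ℕ) := by
          rw [mul_comm (((i : ℕ) / M : ℕ) : ℤ)]; exact_mod_cast hi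
        have e2 : (((j : ℕ) % N : ℕ) : ℤ) + (((j : ℕ) / N : ℕ) : ℤ) * N = (j : ℕ) := by
          rw [mul_comm (((j : ℕ) / N : ℕ) : ℤ)]; exact_mod_cast hj
        rw [e1, e2] at this
        simpa using this
    _ ≤ ∏ _q : Fin a × Fin b, patCount2 X M N :=
        Finset.prod_le_prod' fun q _ => ncard_range_rectPattern_le hX M N _
    _ = _ := by simp

theorem bddBelow_entropy2_range {A : Type*} (X : Set (ℤ × ℤ → A)) :
    BddBelow (Set.range fun n : ℕ =>
      Real.logb 2 (patCount2 X (n + 1) (n + 1)) / ((n : ℝ) + 1) ^ 2) := by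
  refine ⟨0, ?_⟩
  rintro _ ⟨n, rfl⟩
  exact div_nonneg (div_nonneg (Real.log_natCast_nonneg _) (Real.log_nonneg (by norm_num)))
    (by positivity)

theorem logb_patCount2_mul_le {A : Type*} [Finite A] {X : Set (ℤ × ℤ → A)}
    (hX : ∀ (v : ℤ × ℤ) (x : ℤ × ℤ → A), x ∈ X → shift2 v x ∈ X) (hne : X.Nonempty)
    (a b M N : ℕ) :
    Real.logb 2 (patCount2 X (a * M) (b * N)) ≤ (a * b : ℝ) * Real.logb 2 (patCount2 X M N) := by
  have h := patCount2_mul_le_pow hX a b M N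
  have h1 : (patCount2 X (a * M) (b * N) : ℝ) ≤ (patCount2 X M N : ℝ) ^ (a * b) := by
    exact_mod_cast h
  have h2 := Real.logb_le_logb_of_le (b := 2) (by norm_num)
    (by exact_mod_cast patCount2_pos hne _ _) h1
  rw [Real.logb_pow] at h2
  exact_mod_cast h2

theorem mul_entropy2_le_logb_patCount2 {A : Type*} [Finite A] {X : Set (ℤ × ℤ → A)}
    (hX : ∀ (v : ℤ × ℤ) (x : ℤ × ℤ → A), x ∈ X → shift2 v x ∈ X) (hne : X.Nonempty)
    {M N : ℕ} (hM : 0 < M) (hN : 0 < N) :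
    (M * N : ℝ) * entropy2 X ≤ Real.logb 2 (patCount2 X M N) := by
  have h1 := logb_patCount2_mul_le hX hne N M M N
  have hMN : 0 < M * N := Nat.mul_pos hM hN
  have h2 := ciInf_le (bddBelow_entropy2_range X) (M * N - 1)
  have e : M * N - 1 + 1 = M * N := by omega
  have e' : ((M * N - 1 : ℕ) : ℝ) + 1 = M * N := by exact_mod_cast e
  have hpos : (0 : ℝ) < M * N := by exact_mod_cast hMN
  simp only [e, e'] at h2
  change entropy2 X ≤ _ at h2
  rw [le_div_iff₀ (by positivity)] at h2
  rw [mul_comm N M] at h1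
  refine le_of_mul_le_mul_left ?_ hpos
  calc _ = entropy2 X * (M * N : ℝ) ^ 2 := by ring
    _ ≤ _ := h2
    _ ≤ _ := h1
    _ = _ := by ring

theorem exists_logb_patCount2_le {A : Type*} [Finite A] {X : Set (ℤ × ℤ → A)}
    (hX : ∀ (v : ℤ × ℤ) (x : ℤ × ℤ → A), x ∈ X → shift2 v x ∈ X) (hne : X.Nonempty)
    {e : ℝ} (he : entropy2 X < e) :
    ∃ k : ℕ, ∀ M N : ℕ, Real.logb 2 (patCount2 X M N) ≤ ((M : ℝ) + k) * ((N : ℝ) + k) * e := by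
  obtain ⟨n, hn⟩ := exists_lt_of_ciInf_lt he
  refine ⟨n + 1, fun M N => ?_⟩
  set k := n + 1 with hk
  have hk0 : 0 < k := Nat.succ_pos n
  have hkR : (0 : ℝ) < k := by exact_mod_cast hk0
  have hkn : (n : ℝ) + 1 = k := by rw [hk]; push_cast; ring
  rw [hkn, div_lt_iff₀ (by positivity)] at hn
  have hlog : 0 ≤ Real.logb 2 (patCount2 X k k) :=
    div_nonneg (Real.log_natCast_nonneg _) (Real.log_nonneg (by norm_num))
  have hmono := patCount2_mono X (M := M) (N := N) (M' := (M / k + 1) * k) (N' := (N / k + 1) * k)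
    (Nat.lt_div_mul_add hk0 |>.le.trans (by rw [add_mul, one_mul]))
    (Nat.lt_div_mul_add hk0 |>.le.trans (by rw [add_mul, one_mul]))
  have h1 : Real.logb 2 (patCount2 X M N) ≤
      Real.logb 2 (patCount2 X ((M / k + 1) * k) ((N / k + 1) * k)) :=
    Real.logb_le_logb_of_le (by norm_num) (by exact_mod_cast patCount2_pos hne _ _)
      (by exact_mod_cast hmono)
  have h2 := logb_patCount2_mul_le hX hne (M / k + 1) (N / k + 1) k k
  have hd : ∀ K : ℕ, ((K / k + 1 : ℕ) : ℝ) * k ≤ K + k := by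
    intro K
    have := Nat.div_mul_le_self K k
    have : (K / k + 1) * k ≤ K + k := by rw [add_mul, one_mul]; omega
    exact_mod_cast this
  have he0 : 0 ≤ e := by
    by_contra! hneg
    nlinarith [sq_nonneg (k : ℝ), pow_pos hkR 2]
  calc _ ≤ _ := h1
    _ ≤ _ := h2
    _ ≤ ((M / k + 1 : ℕ) : ℝ) * ((N / k + 1 : ℕ) : ℝ) * (e * (k : ℝ) ^ 2) := by gcongr
    _ = (((M / k + 1 : ℕ) : ℝ) * k) * (((N / k + 1 : ℕ) : ℝ) * k) * e := by ring
    _ ≤ _ := by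
      gcongr
      · exact hd M
      · exact hd N

/-- A continuous map from a compact set of configurations to a discrete space depends only on a
bounded window. -/
theorem exists_window_of_continuous {A D : Type*} [TopologicalSpace A] [DiscreteTopology A]
    [TopologicalSpace D] [DiscreteTopology D] {W : Set (ℤ × ℤ → A)} (hW : IsCompact W)
    (f : W → D) (hf : Continuous f) :
    ∃ r : ℕ, ∀ x y : W,
      (∀ a b : ℤ, |a| ≤ r → |b| ≤ r → (x : ℤ × ℤ → A) (a, b) = (y : ℤ × ℤ → A) (a, b)) →
        f x = f y := by
  have := isCompact_iff_compactSpace.mp hW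
  let K : ℕ → Set (W × W) := fun r => {p | f p.1 ≠ f p.2 ∧ ∀ a b : ℤ, |a| ≤ r → |b| ≤ r →
    (p.1 : ℤ × ℤ → A) (a, b) = (p.2 : ℤ × ℤ → A) (a, b)}
  have hanti : ∀ {r s : ℕ}, r ≤ s → K s ⊆ K r := by
    intro r s hrs p hp
    have : (r : ℤ) ≤ s := by exact_mod_cast hrs
    exact ⟨hp.1, fun a b ha hb => hp.2 a b (ha.trans this) (hb.trans this)⟩
  have hcl : ∀ r, IsClosed (K r) := by
    intro r
    have h1 : IsClosed {p : W × W | f p.1 ≠ f p.2} := by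
      have hc : Continuous fun p : W × W => (f p.1, f p.2) := by fun_prop
      exact (isClosed_discrete {q : D × D | q.1 ≠ q.2}).preimage hc
    have h2 : IsClosed {p : W × W | ∀ a b : ℤ, |a| ≤ r → |b| ≤ r →
        (p.1 : ℤ × ℤ → A) (a, b) = (p.2 : ℤ × ℤ → A) (a, b)} := by
      simp only [Set.ofPred_forall]
      exact isClosed_iInter fun a => isClosed_iInter fun b => isClosed_iInter fun _ =>
        isClosed_iInter fun _ => isClosed_eq
          ((continuous_apply (a, b)).comp (continuous_subtype_val.comp continuous_fst))
          ((continuous_apply (a, b)).comp (continuous_subtype_val.comp continuous_snd))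
    exact h1.inter h2
  by_contra! hcon
  have hne : ∀ r, (K r).Nonempty := by
    intro r
    obtain ⟨x, y, hxy, hfxy⟩ := hcon r
    exact ⟨(x, y), hfxy, hxy⟩
  obtain ⟨p, hp⟩ := IsCompact.nonempty_iInter_of_sequence_nonempty_isCompact_isClosed K
    (fun i => hanti i.le_succ) hne (hcl 0).isCompact hcl
  simp only [Set.mem_iInter] at hp
  refine (hp 0).1 (congrArg f (Subtype.ext (funext fun q => ?_)))
  refine (hp (q.1.natAbs + q.2.natAbs)).2 q.1 q.2 ?_ ?_ <;> push_cast <;> simp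

theorem le_of_forall_mul_sq_le {a b b' c d d' e : ℝ}
    (h : ∀ N : ℕ, 0 < N → a * (N : ℝ) ^ 2 ≤ c + (b * N + d) * (b' * N + d') * e) :
    a ≤ b * b' * e := by
  have h0 := tendsto_inv_atTop_nhds_zero_nat (𝕜 := ℝ)
  have hlim : Tendsto (fun N : ℕ => c * ((N : ℝ)⁻¹ * (N : ℝ)⁻¹) +
      (b + d * (N : ℝ)⁻¹) * (b' + d' * (N : ℝ)⁻¹) * e) atTop
      (nhds (c * (0 * 0) + (b + d * 0) * (b' + d' * 0) * e)) :=
    ((h0.mul h0).const_mul c).add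
      ((((h0.const_mul d).const_add b).mul ((h0.const_mul d').const_add b')).mul_const e)
  simp only [mul_zero, add_zero, zero_add] at hlim
  refine ge_of_tendsto hlim ?_
  filter_upwards [eventually_gt_atTop 0] with N hN
  have hNR : (0 : ℝ) < N := by exact_mod_cast hN
  have := h N hN
  rw [← le_div_iff₀ (by positivity)] at this
  refine this.trans (le_of_eq ?_)
  field_simp

theorem shift2_mem_of_image_eq {A : Type*} {Z : Set (ℤ × ℤ → A)} {v w : ℤ × ℤ}
    (hv : shift2 v '' Z = Z) (hw : shift2 w '' Z = Z) (k l : ℤ) {x : ℤ × ℤ → A} (hx : x ∈ Z) :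
    shift2 (k • v + l • w) x ∈ Z := by
  let G : AddSubgroup (ℤ × ℤ) :=
    { carrier := {u | ∀ y, shift2 u y ∈ Z ↔ y ∈ Z}
      zero_mem' := fun y => by rw [shift2_zero]
      add_mem' := fun {a b} ha hb y => by rw [← shift2_shift2, ha, hb]
      neg_mem' := fun {a} ha y => by rw [← ha, shift2_shift2, add_neg_cancel, shift2_zero] }
  have key : ∀ u : ℤ × ℤ, shift2 u '' Z = Z → u ∈ G := by
    intro u hu y
    constructor
    · intro h
      rw [← hu] at h
      obtain ⟨z, hz, hzy⟩ := h
      have := congrArg (shift2 (-u)) hzy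
      rw [shift2_shift2, shift2_shift2, neg_add_cancel, shift2_zero, shift2_zero] at this
      exact this ▸ hz
    · exact fun h => hu ▸ Set.mem_image_of_mem _ h
  exact (G.add_mem (G.zsmul_mem (key v hv) k) (G.zsmul_mem (key w hw) l) x).mpr hx

theorem exists_patCount2_le_of_homeomorph {A B : Type*} [Finite A]
    [TopologicalSpace A] [DiscreteTopology A] [TopologicalSpace B] [DiscreteTopology B]
    {X Z : Set (ℤ × ℤ → A)} {Y : Set (ℤ × ℤ → B)}
    (hX : ∀ (v : ℤ × ℤ) (x : ℤ × ℤ → A), x ∈ X → shift2 v x ∈ X)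
    (hZX : Z ⊆ X) (hZ : IsCompact Z) {m n : ℕ} (hm : 0 < m) (hn : 0 < n) (φ : Z ≃ₜ Y)
    (hφ : ∀ (z : Z) (k l : ℤ), ∃ hz : shift2 (k * (m : ℤ), l * (n : ℤ)) (z : ℤ × ℤ → A) ∈ Z,
      (φ ⟨_, hz⟩ : ℤ × ℤ → B) = shift2 (k, l) (φ z : ℤ × ℤ → B)) :
    ∃ r : ℕ, ∀ N : ℕ, patCount2 Y N N ≤ patCount2 X (m * N + 2 * r) (n * N + 2 * r) := by
  obtain ⟨r, hr⟩ := exists_window_of_continuous hZ (fun z => (φ z : ℤ × ℤ → B) (0, 0))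
    ((continuous_apply (0, 0)).comp (continuous_subtype_val.comp φ.continuous))
  refine ⟨r, fun N => ?_⟩
  rw [patCount2_eq_ncard_range]
  calc _ ≤ (Set.range fun y : Y => rectPattern (m * N + 2 * r) (n * N + 2 * r) (-r, -r)
          (φ.symm y : ℤ × ℤ → A)).ncard := by
        apply ncard_range_le_of_determined
        intro y y' h
        rw [rectPattern_eq_iff] at h
        funext i j
        have key : ∀ u : Y, ∃ hz, rectPattern N N 0 (u : ℤ × ℤ → B) i j =
            (φ ⟨shift2 (-(i : ℤ) * m, -(j : ℤ) * n) (φ.symm u : ℤ × ℤ → A), hz⟩ :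
              ℤ × ℤ → B) (0, 0) := by
          intro u
          obtain ⟨hz, e⟩ := hφ (φ.symm u) (-(i : ℤ)) (-(j : ℤ))
          exact ⟨hz, by rw [e]; simp [shift2, rectPattern]⟩
        obtain ⟨hz, e⟩ := key y
        obtain ⟨hz', e'⟩ := key y'
        rw [e, e']
        apply hr
        intro a b ha hb
        rw [abs_le] at ha hb
        have hi : (i : ℤ) + 1 ≤ N := by have := i.2; omega
        have hj : (j : ℤ) + 1 ≤ N := by have := j.2; omega
        have h1 : (0 : ℤ) ≤ i * m := by positivity
        have h2 : (0 : ℤ) ≤ j * n := by positivity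
        have h3 : (i : ℤ) * m + 1 ≤ m * N := by
          have : (1 : ℤ) ≤ m := by exact_mod_cast hm
          nlinarith
        have h4 : (j : ℤ) * n + 1 ≤ n * N := by
          have : (1 : ℤ) ≤ n := by exact_mod_cast hn
          nlinarith
        simp only [shift2, Prod.mk_sub_mk, neg_mul, sub_neg_eq_add]
        apply h <;> push_cast <;> linarith
    _ ≤ (Set.range fun x : X => rectPattern (m * N + 2 * r) (n * N + 2 * r) (-r, -r)
          (x : ℤ × ℤ → A)).ncard := by
        refine Set.ncard_le_ncard ?_ (Set.toFinite _)
        rintro _ ⟨y, rfl⟩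
        exact ⟨⟨φ.symm y, hZX (φ.symm y).2⟩, rfl⟩
    _ ≤ _ := ncard_range_rectPattern_le hX _ _ _

theorem exists_patCount2_le_mul_of_cover {A B : Type*} [Finite A] [Finite B]
    [TopologicalSpace A] [DiscreteTopology A] [TopologicalSpace B] [DiscreteTopology B]
    {X Z : Set (ℤ × ℤ → A)} {Y : Set (ℤ × ℤ → B)}
    (hY : ∀ (v : ℤ × ℤ) (y : ℤ × ℤ → B), y ∈ Y → shift2 v y ∈ Y) (hYc : IsCompact Y)
    {m n : ℕ} (hm : 0 < m) (hn : 0 < n) (φ : Z ≃ₜ Y)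
    (hφ : ∀ (z : Z) (k l : ℤ), ∃ hz : shift2 (k * (m : ℤ), l * (n : ℤ)) (z : ℤ × ℤ → A) ∈ Z,
      (φ ⟨_, hz⟩ : ℤ × ℤ → B) = shift2 (k, l) (φ z : ℤ × ℤ → B))
    (hcov : ∀ x ∈ X, ∃ q : Fin m × Fin n, x ∈ shift2 ((q.1 : ℤ), (q.2 : ℤ)) '' Z) :
    ∃ r : ℕ, ∀ N : ℕ, patCount2 X (m * N) (n * N) ≤
      (m * n) * patCount2 Y (N + 1 + 2 * r) (N + 1 + 2 * r) := by
  obtain ⟨r, hr⟩ := exists_window_of_continuous hYc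
    (fun y => rectPattern m n 0 (φ.symm y : ℤ × ℤ → A))
    (continuous_pi fun _ => continuous_pi fun _ =>
      (continuous_apply _).comp (continuous_subtype_val.comp φ.symm.continuous))
  refine ⟨r, fun N => ?_⟩
  rw [patCount2_eq_ncard_range]
  calc _ ≤ (Set.range fun p : (Fin m × Fin n) × Y => rectPattern (m * N) (n * N) 0
          (shift2 ((p.1.1 : ℤ), (p.1.2 : ℤ)) (φ.symm p.2 : ℤ × ℤ → A))).ncard := by
        refine Set.ncard_le_ncard ?_ (Set.toFinite _)
        rintro _ ⟨x, rfl⟩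
        obtain ⟨q, z, hz, e⟩ := hcov x x.2
        exact ⟨(q, φ ⟨z, hz⟩), by simp [e]⟩
    _ ≤ (Set.range fun p : (Fin m × Fin n) × Y => p.1).ncard *
        (Set.range fun p : (Fin m × Fin n) × Y => rectPattern (N + 1 + 2 * r) (N + 1 + 2 * r)
          (-r - 1, -r - 1) (p.2 : ℤ × ℤ → B)).ncard := by
        apply ncard_range_le_mul
        rintro ⟨q, y⟩ ⟨q', y'⟩ (rfl : q = q') h
        simp only [rectPattern_eq_iff] at h ⊢
        intro a b ha ha' hb hb'
        have hmZ : (0 : ℤ) < m := by exact_mod_cast hm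
        have hnZ : (0 : ℤ) < n := by exact_mod_cast hn
        have hq1 : (q.1 : ℤ) < m := by exact_mod_cast q.1.2
        have hq2 : (q.2 : ℤ) < n := by exact_mod_cast q.2.2
        simp only [shift2, Prod.mk_sub_mk]
        push_cast at ha ha' hb hb'
        simp only [Prod.fst_zero, Prod.snd_zero, zero_add] at ha ha' hb hb'
        set c := a - (q.1 : ℤ) with hc
        set d := b - (q.2 : ℤ) with hd
        have hk1 : -1 ≤ c / m := (Int.le_ediv_iff_mul_le hmZ).2 (by linarith)
        have hk2 : c / m < N := (Int.ediv_lt_iff_lt_mul hmZ).2 (by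
          have : (0 : ℤ) ≤ (q.1 : ℕ) := by positivity
          linarith [mul_comm (m : ℤ) N])
        have hl1 : -1 ≤ d / n := (Int.le_ediv_iff_mul_le hnZ).2 (by linarith)
        have hl2 : d / n < N := (Int.ediv_lt_iff_lt_mul hnZ).2 (by
          have : (0 : ℤ) ≤ (q.2 : ℕ) := by positivity
          linarith [mul_comm (n : ℤ) N])
        have key : ∀ u : Y, (φ.symm u : ℤ × ℤ → A) (c, d) =
            (φ.symm ⟨shift2 (-(c / m), -(d / n)) u, hY _ _ u.2⟩ : ℤ × ℤ → A)
              (c % m, d % n) := by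
          intro u
          obtain ⟨hz, e⟩ := hφ (φ.symm u) (-(c / m)) (-(d / n))
          have e2 : (⟨shift2 (-(c / m), -(d / n)) u, hY _ _ u.2⟩ : Y) = φ ⟨_, hz⟩ :=
            Subtype.ext (by rw [e]; simp)
          rw [e2, φ.symm_apply_apply]
          simp only [shift2, Prod.mk_sub_mk, neg_mul, sub_neg_eq_add]
          rw [Int.emod_add_ediv_mul, Int.emod_add_ediv_mul]
        rw [key, key]
        refine (rectPattern_eq_iff.1 (hr ⟨_, hY _ _ y.2⟩ ⟨_, hY _ _ y'.2⟩ ?_)) _ _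
          (Int.emod_nonneg _ hmZ.ne') (by simpa using Int.emod_lt_of_pos _ hmZ)
          (Int.emod_nonneg _ hnZ.ne') (by simpa using Int.emod_lt_of_pos _ hnZ)
        intro s t hs ht
        rw [abs_le] at hs ht
        simp only [shift2, Prod.mk_sub_mk, sub_neg_eq_add]
        apply h <;> push_cast <;> linarith
    _ ≤ _ := by
        refine Nat.mul_le_mul ?_ ?_
        · refine (Set.ncard_le_card _).trans ?_
          simp
        · refine le_trans (Set.ncard_le_ncard ?_ (Set.toFinite _))
            (ncard_range_rectPattern_le hY _ _ (-r - 1, -r - 1))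
          rintro _ ⟨p, rfl⟩
          exact ⟨p.2, rfl⟩

/-- if `X` is an `(m,n)`-th root of `Y` then `h(Y) = m·n·h(X)`. -/
theorem stmt3 {A B : Type*} [Fintype A] [TopologicalSpace A] [DiscreteTopology A]
    [Fintype B] [TopologicalSpace B] [DiscreteTopology B]
    (X : Set (ℤ × ℤ → A)) (Y : Set (ℤ × ℤ → B))
    (hX : IsSubshift2 X) (hY : IsSubshift2 Y)
    (hXne : X.Nonempty) (hYne : Y.Nonempty)
    (m n : ℕ) (hm : 0 < m) (hn : 0 < n) (hroot : IsRoot X Y m n) :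
    entropy2 Y = (m : ℝ) * (n : ℝ) * entropy2 X := by
  obtain ⟨Z, hZX, hZcl, hZm, hZn, ⟨φ, hφ⟩, -, hcov⟩ := hroot
  have hXc : IsCompact X := hX.1.isCompact
  have hZ : IsCompact Z := by
    have h := hX.1.isClosedEmbedding_subtypeVal.isClosedMap _ hZcl.1
    have e : ((↑) : X → ℤ × ℤ → A) '' {x : X | (x : ℤ × ℤ → A) ∈ Z} = Z := by
      ext x
      exact ⟨by rintro ⟨y, hy, rfl⟩; exact hy, fun hx => ⟨⟨x, hZX hx⟩, hx, rfl⟩⟩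
    exact (e ▸ h).isCompact
  have hequiv : ∀ (z : Z) (k l : ℤ),
      ∃ hz : shift2 (k * (m : ℤ), l * (n : ℤ)) (z : ℤ × ℤ → A) ∈ Z,
        (φ ⟨_, hz⟩ : ℤ × ℤ → B) = shift2 (k, l) (φ z : ℤ × ℤ → B) := by
    intro z k l
    have hz := shift2_mem_of_image_eq hZm hZn k l z.2
    have e : k • ((m : ℤ), (0 : ℤ)) + l • ((0 : ℤ), (n : ℤ)) = (k * (m : ℤ), l * (n : ℤ)) := by
      simp
    rw [e] at hz
    exact ⟨hz, hφ z k l hz⟩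
  have hmR : (0 : ℝ) < m := by exact_mod_cast hm
  have hnR : (0 : ℝ) < n := by exact_mod_cast hn
  apply le_antisymm
  · obtain ⟨r, hr⟩ := exists_patCount2_le_of_homeomorph hX.2 hZX hZ hm hn φ hequiv
    rw [← div_le_iff₀' (by positivity)]
    refine le_of_forall_gt_imp_ge_of_dense fun e he => ?_
    obtain ⟨k, hk⟩ := exists_logb_patCount2_le hX.2 hXne he
    rw [div_le_iff₀' (by positivity)]
    refine le_of_forall_mul_sq_le (c := 0) (d := 2 * r + k) (d' := 2 * r + k) fun N hN => ?_
    have h1 := mul_entropy2_le_logb_patCount2 hY.2 hYne hN hN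
    have h2 : Real.logb 2 (patCount2 Y N N) ≤
        Real.logb 2 (patCount2 X (m * N + 2 * r) (n * N + 2 * r)) :=
      Real.logb_le_logb_of_le (by norm_num) (by exact_mod_cast patCount2_pos hYne _ _)
        (by exact_mod_cast hr N)
    have h3 := hk (m * N + 2 * r) (n * N + 2 * r)
    push_cast at h3
    calc _ = (N * N : ℝ) * entropy2 Y := by ring
      _ ≤ _ := (h1.trans h2).trans h3
      _ = _ := by ring
  · obtain ⟨r, hr⟩ := exists_patCount2_le_mul_of_cover hY.2 hY.1.isCompact hm hn φ hequiv
      fun x hx => (hcov x hx).exists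
    refine le_of_forall_gt_imp_ge_of_dense fun e he => ?_
    obtain ⟨k, hk⟩ := exists_logb_patCount2_le hY.2 hYne he
    suffices h : (m : ℝ) * n * entropy2 X ≤ 1 * 1 * e by simpa using h
    refine le_of_forall_mul_sq_le (c := Real.logb 2 (m * n)) (d := 1 + 2 * r + k)
      (d' := 1 + 2 * r + k) fun N hN => ?_
    have h1 := mul_entropy2_le_logb_patCount2 hX.2 hXne (Nat.mul_pos hm hN) (Nat.mul_pos hn hN)
    have hpos : (0 : ℝ) < patCount2 Y (N + 1 + 2 * r) (N + 1 + 2 * r) := by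
      exact_mod_cast patCount2_pos hYne _ _
    have h2 : Real.logb 2 (patCount2 X (m * N) (n * N)) ≤
        Real.logb 2 ((m * n : ℝ) * patCount2 Y (N + 1 + 2 * r) (N + 1 + 2 * r)) :=
      Real.logb_le_logb_of_le (by norm_num) (by exact_mod_cast patCount2_pos hXne _ _)
        (by exact_mod_cast hr N)
    rw [Real.logb_mul (by positivity) hpos.ne'] at h2
    have h3 := hk (N + 1 + 2 * r) (N + 1 + 2 * r)
    push_cast at h1 h3
    calc _ = (m * N * (n * N) : ℝ) * entropy2 X := by ring
      _ ≤ _ := h1.trans h2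
      _ ≤ _ := add_le_add_right h3 _
      _ = _ := by ring
end

section
/- Let H ⊆ A^ℤ be a transitive one-dimensional SFT with h(H) > 0 whose forbidden words all have length at most M, and let h < h(H) be a real number. Then there exist an integer α > M, words u, w₁, w₂ ∈ L_H with |u| = |w₁| = |w₂| = α, and a word s ∈ L_H(M) satisfying: each of s·u, s·w₁, s·w₂ belongs to L_H with length-M suffix equal to s; u·w·w₁ ∈ L_H for every finite concatenation w of copies of w₁ and w₂; in any word u·w·w₁ of this form, u occurs as a factor only as the prefix; h(H_u) > h; and moreover, defining Ñ_H(n) = #{v : |v| = n, u does not occur in v, and w₁·v·u ∈ L_H}, the sequence log₂(Ñ_H(nα))/(nα) converges to h(H_u) as n → ∞. -/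
open Filter

namespace SymbolicWord

variable {A : Type*}

/-- The word `u` occurs in the word `Z` at position `i`. -/
def OccAt (u Z : List A) (i : ℕ) : Prop :=
  ∀ k < u.length, Z[i + k]? = u[k]?

lemma occAt_iff_prefix {u Z : List A} {i : ℕ} : OccAt u Z i ↔ u <+: Z.drop i := by
  rw [List.prefix_iff_getElem?]
  refine forall₂_congr fun k hk => ?_
  rw [List.getElem?_drop, List.getElem?_eq_getElem hk]

lemma occAt_append_left {u X Z : List A} {i : ℕ} :
    OccAt u (X ++ Z) (X.length + i) ↔ OccAt u Z i := by
  refine forall₂_congr fun k hk => ?_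
  rw [List.getElem?_append_right (by omega)]
  simp [Nat.add_assoc]

lemma OccAt.append_right {u Z : List A} {i : ℕ} (h : OccAt u Z i) (Y : List A) :
    OccAt u (Z ++ Y) i := by
  intro k hk
  have := h k hk
  rw [List.getElem?_eq_getElem hk] at this
  obtain ⟨h1, -⟩ := List.getElem?_eq_some_iff.1 this
  rw [List.getElem?_append_left h1, this, List.getElem?_eq_getElem hk]

lemma OccAt.of_append {u Z Y : List A} {i : ℕ} (h : OccAt u (Z ++ Y) i)
    (hi : i + u.length ≤ Z.length) : OccAt u Z i := by
  intro k hk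
  rw [← h k hk, List.getElem?_append_left (by omega)]

lemma OccAt.trans {m u Z : List A} {i j : ℕ} (h : OccAt m u j) (h' : OccAt u Z i) :
    OccAt m Z (i + j) := by
  intro k hk
  have := h k hk
  rw [List.getElem?_eq_getElem hk] at this
  obtain ⟨h1, -⟩ := List.getElem?_eq_some_iff.1 this
  rw [Nat.add_assoc, h' _ h1, this, List.getElem?_eq_getElem hk]

lemma occAt_self (x u y : List A) : OccAt u (x ++ u ++ y) x.length := by
  rw [List.append_assoc]
  exact (occAt_append_left (i := 0)).2 (occAt_iff_prefix.2 (by simp))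

lemma OccAt.exists_eq {u Z : List A} {i : ℕ} (h : OccAt u Z i) (hu : u ≠ []) :
    ∃ x y, Z = x ++ u ++ y ∧ x.length = i := by
  obtain ⟨y, hy⟩ := occAt_iff_prefix.1 h
  refine ⟨Z.take i, y, ?_, ?_⟩
  · rw [List.append_assoc, hy, List.take_append_drop]
  · have : (Z.drop i).length ≠ 0 := by
      rw [← hy]
      have := List.length_pos_iff.2 hu
      simp only [List.length_append]
      omega
    rw [List.length_drop] at this
    rw [List.length_take]
    omega

lemma OccAt.add_length_le {u Z : List A} {i : ℕ} (h : OccAt u Z i) (hu : u ≠ []) :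
    i + u.length ≤ Z.length := by
  obtain ⟨x, y, rfl, rfl⟩ := h.exists_eq hu
  simp only [List.length_append]
  omega

lemma infix_iff_occAt {u Z : List A} (hu : u ≠ []) : u <:+: Z ↔ ∃ i, OccAt u Z i := by
  constructor
  · rintro ⟨x, y, rfl⟩
    exact ⟨_, occAt_self x u y⟩
  · rintro ⟨i, hi⟩
    obtain ⟨x, y, rfl, -⟩ := hi.exists_eq hu
    exact ⟨x, y, rfl⟩

lemma exists_last_occ {u : List A} (hu : u ≠ []) {Z : List A} (hZ : ∃ i, OccAt u Z i) :
    ∃ x y, Z = x ++ u ++ y ∧ ∀ k, OccAt u Z k → k ≤ x.length := by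
  classical
  obtain ⟨i, hi⟩ := hZ
  have hle : ∀ k, OccAt u Z k → k ≤ Z.length := fun k hk => by
    have := hk.add_length_le hu
    omega
  have hj := Nat.findGreatest_spec (P := OccAt u Z) (hle i hi) hi
  obtain ⟨x, y, h1, h2⟩ := hj.exists_eq hu
  refine ⟨x, y, h1, fun k hk => ?_⟩
  rw [h2]
  exact Nat.le_findGreatest (hle k hk) hk

lemma exists_first_occ {u : List A} (hu : u ≠ []) {Z : List A} (hZ : ∃ i, OccAt u Z i) :
    ∃ x y, Z = x ++ u ++ y ∧ ∀ k, OccAt u Z k → x.length ≤ k := by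
  classical
  obtain ⟨x, y, h1, h2⟩ := (Nat.find_spec hZ).exists_eq hu
  refine ⟨x, y, h1, fun k hk => ?_⟩
  rw [h2]
  exact Nat.find_min' hZ hk

/-- In a word starting and ending with `u`, a middle part whose padded version avoids `u`
lies between two consecutive occurrences of `u`. -/
lemma exists_between_occ {u : List A} (hu : u ≠ []) (l c₁ c c₃ r : List A)
    (h₁ : c₁.length = u.length) (h₃ : c₃.length = u.length) (hc : ¬ u <:+: c₁ ++ c ++ c₃) :
    ∃ x y v₁ v₂, u ++ l ++ c₁ ++ c ++ c₃ ++ r ++ u = x ++ u ++ (v₁ ++ c ++ v₂) ++ u ++ y ∧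
      (∀ k, OccAt u (v₁ ++ c ++ v₂ ++ u) k → (v₁ ++ c ++ v₂).length ≤ k) ∧
      v₁.length ≤ l.length + c₁.length ∧ v₂.length ≤ c₃.length + r.length := by
  obtain ⟨x, v₁, hx, hx'⟩ := exists_last_occ hu (Z := u ++ (l ++ c₁))
    ⟨0, by simpa using occAt_self [] u (l ++ c₁)⟩
  obtain ⟨v₂, y, hy, hy'⟩ := exists_first_occ hu (Z := c₃ ++ r ++ u)
    ⟨_, by simpa using occAt_self (c₃ ++ r) u []⟩
  have hlx := congrArg List.length hx
  have hly := congrArg List.length hy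
  have hyl : v₂.length ≤ (c₃ ++ r).length :=
    hy' _ (by simpa using occAt_self (c₃ ++ r) u [])
  simp only [List.length_append] at hlx hly hyl
  rw [infix_iff_occAt hu] at hc
  refine ⟨x, y, v₁, v₂, ?_, ?_, by omega, by omega⟩
  · calc u ++ l ++ c₁ ++ c ++ c₃ ++ r ++ u = (u ++ (l ++ c₁)) ++ c ++ (c₃ ++ r ++ u) := by simp
      _ = _ := by rw [hx, hy]; simp
  intro k hk
  by_contra! hlt
  simp only [List.length_append] at hlt
  have hk2 : OccAt u (v₁ ++ c ++ (c₃ ++ r ++ u)) k := by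
    rw [hy]
    simpa using hk.append_right y
  by_cases h1 : k < v₁.length + c.length
  · have hk3 : OccAt u (v₁ ++ (c ++ c₃)) k := by
      refine OccAt.of_append (Y := r ++ u) (by simpa using hk2) ?_
      simp only [List.length_append]
      omega
    by_cases h2 : k + u.length ≤ v₁.length
    · have h4 : OccAt u (x ++ u ++ v₁) ((x ++ u).length + k) :=
        occAt_append_left.2 (hk3.of_append h2)
      rw [← hx] at h4
      have := hx' _ h4
      have := List.length_pos_iff.2 hu
      simp only [List.length_append] at *
      omega
    · have hs : x ++ u ++ v₁ = u ++ l ++ c₁ := by rw [← hx]; simp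
      rcases List.append_eq_append_iff.1 hs with ⟨d, hd, hd'⟩ | ⟨d, hd, hd'⟩
      · subst hd'
        refine hc ⟨k - d.length, ?_⟩
        have hkd : k = d.length + (k - d.length) := by
          simp only [List.length_append] at h2 ⊢
          omega
        rw [hkd, List.append_assoc] at hk3
        simpa using occAt_append_left.1 hk3
      · subst hd'
        refine hc ⟨d.length + k, ?_⟩
        have := (occAt_append_left (X := d)).2 hk3
        simpa using this
  · have hkd : k = (v₁ ++ c).length + (k - (v₁ ++ c).length) := by
      simp only [List.length_append]
      omega
    rw [hkd] at hk2
    have := hy' _ (occAt_append_left.1 hk2)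
    simp only [List.length_append] at this
    omega

/-! ### Languages of one-dimensional subshifts -/

lemma wordIn_iff {H : Set (ℤ → A)} {w : List A} :
    wordIn H w ↔ ∃ x ∈ H, ∃ i : ℤ, ∀ k < w.length, w[k]? = some (x (i + k)) := by
  unfold wordIn occursIn1
  refine exists_congr fun x => and_congr_right fun _ => exists_congr fun i =>
    forall₂_congr fun k hk => ?_
  rw [List.getElem?_eq_getElem hk, List.get_eq_getElem, Option.some_inj, eq_comm]

lemma wordIn_of_infix {H : Set (ℤ → A)} {v w : List A} (hv : v <:+: w) (hw : wordIn H w) :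
    wordIn H v := by
  obtain ⟨a, b, rfl⟩ := hv
  obtain ⟨x, hx, i, hi⟩ := wordIn_iff.1 hw
  refine wordIn_iff.2 ⟨x, hx, i + a.length, fun k hk => ?_⟩
  have := hi (a.length + k) (by simp only [List.length_append]; omega)
  rw [List.append_assoc, List.getElem?_append_right (by omega), List.getElem?_append_left
    (by omega)] at this
  rw [show a.length + k - a.length = k by omega] at this
  rw [this]
  push_cast
  rw [add_assoc]

lemma wordIn_extend {H : Set (ℤ → A)} {v : List A} (hv : wordIn H v) (k : ℕ) :
    ∃ l r : List A, l.length = k ∧ r.length = k ∧ wordIn H (l ++ v ++ r) := by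
  obtain ⟨x, hx, i, hi⟩ := wordIn_iff.1 hv
  refine ⟨List.ofFn fun j : Fin k => x (i - k + j),
    List.ofFn fun j : Fin k => x (i + v.length + j), by simp, by simp,
    wordIn_iff.2 ⟨x, hx, i - k, fun j hj => ?_⟩⟩
  simp only [List.length_append, List.length_ofFn] at hj
  rcases lt_or_ge j k with h1 | h1
  · rw [List.append_assoc, List.getElem?_append_left (by simpa), List.getElem?_ofFn,
      dif_pos h1]
  · rcases lt_or_ge j (k + v.length) with h2 | h2
    · rw [List.getElem?_append_left (by simpa), List.getElem?_append_right (by simpa),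
        List.length_ofFn, hi _ (by omega)]
      congr 2
      push_cast [h1]
      ring
    · rw [List.getElem?_append_right (by simpa), List.length_append, List.length_ofFn,
        List.getElem?_ofFn, dif_pos (by omega)]
      congr 2
      push_cast [h2]
      ring

lemma wordIn_glue {F : Finset (List A)} {M : ℕ} (hF : ∀ w ∈ F, w.length ≤ M) {a s b : List A}
    (hs : s.length = M) (ha : wordIn (SFT1 F) (a ++ s)) (hb : wordIn (SFT1 F) (s ++ b)) :
    wordIn (SFT1 F) (a ++ s ++ b) := by
  obtain ⟨x, hx, i, hi⟩ := wordIn_iff.1 ha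
  obtain ⟨y, hy, j, hj⟩ := wordIn_iff.1 hb
  have hover : ∀ n : ℤ, i + a.length ≤ n → n < i + a.length + M →
      x n = y (n - i - a.length + j) := by
    intro n h1 h2
    obtain ⟨m, hm⟩ := Int.eq_ofNat_of_zero_le (sub_nonneg.2 h1)
    have e1 := hi (a.length + m) (by simp only [List.length_append]; omega)
    have e2 := hj m (by simp only [List.length_append]; omega)
    rw [List.getElem?_append_right (by omega), Nat.add_sub_cancel_left] at e1
    rw [List.getElem?_append_left (by omega), e1, Option.some_inj] at e2
    rw [show n = i + ↑(a.length + m) by push_cast; omega, e2]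
    congr 1
    push_cast
    ring
  let z : ℤ → A := fun n => if n < i + a.length + M then x n else y (n - i - a.length + j)
  have hz1 : ∀ n, n < i + a.length + M → z n = x n := fun n hn => if_pos hn
  have hz2 : ∀ n, i + a.length ≤ n → z n = y (n - i - a.length + j) := by
    intro n hn
    by_cases h : n < i + a.length + M
    · rw [hz1 n h, hover n hn h]
    · exact if_neg h
  refine wordIn_iff.2 ⟨z, ?_, i, ?_⟩
  · rintro f hf ⟨q, hq⟩
    have hfM := hF f hf
    rcases lt_or_ge q (i + a.length) with h | h
    · exact hx f hf ⟨q, fun n hn => by rw [← hz1 _ (by omega), hq n hn]⟩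
    · refine hy f hf ⟨q - i - a.length + j, fun n hn => ?_⟩
      rw [← hq n hn, hz2 _ (by omega)]
      congr 1
      ring
  · intro k hk
    simp only [List.length_append] at hk
    rcases lt_or_ge k (a.length + M) with h | h
    · rw [List.getElem?_append_left (by simp only [List.length_append]; omega),
        hi k (by simp only [List.length_append]; omega), hz1 _ (by omega)]
    · rw [List.append_assoc, List.getElem?_append_right (by omega),
        hj _ (by simp only [List.length_append]; omega), hz2 _ (by omega)]
      congr 2
      push_cast [show a.length ≤ k by omega]
      ring

lemma wordIn_avoid {H : Set (ℤ → A)} {u v : List A} (h : wordIn (avoidWord H u) v) :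
    wordIn H v ∧ ¬ u <:+: v := by
  refine ⟨h.imp fun x hx => ⟨hx.1.1, hx.2⟩, fun huv => ?_⟩
  obtain ⟨x, hx, hux⟩ := wordIn_of_infix huv h
  exact hx.2 hux

/-- Compactness: a word extendable arbitrarily far on both sides to a word of the language
of an SFT that avoids `u` occurs in a point of the SFT avoiding `u`. -/
lemma wordIn_avoid_of_forall_extend [Finite A] {F : Finset (List A)} {u v : List A}
    (h : ∀ k : ℕ, ∃ l r : List A, k ≤ l.length ∧ k ≤ r.length ∧
      wordIn (SFT1 F) (l ++ v ++ r) ∧ ¬ u <:+: l ++ v ++ r) :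
    wordIn (avoidWord (SFT1 F) u) v := by
  have h' : ∀ k : ℕ, ∃ x ∈ SFT1 F, (∀ n < v.length, v[n]? = some (x n)) ∧
      ∀ q : ℤ, -k ≤ q → q + u.length ≤ k →
        ¬ ∀ (n : ℕ) (h : n < u.length), x (q + n) = u.get ⟨n, h⟩ := by
    intro k
    obtain ⟨l, r, hl, hr, hw, hu⟩ := h k
    obtain ⟨x, hx, i, hi⟩ := wordIn_iff.1 hw
    simp only [List.length_append] at hi
    refine ⟨fun n => x (n + (i + l.length)), ?_, ?_, ?_⟩
    · rintro f hf ⟨q, hq⟩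
      refine hx f hf ⟨q + (i + l.length), fun n hn => ?_⟩
      rw [← hq n hn]
      congr 1
      ring
    · intro n hn
      have := hi (l.length + n) (by omega)
      rw [List.append_assoc, List.getElem?_append_right (by omega),
        List.getElem?_append_left (by omega), Nat.add_sub_cancel_left] at this
      rw [this]
      congr 2
      push_cast
      ring
    · intro q hq1 hq2 hq
      apply hu
      obtain ⟨m, hm⟩ := Int.eq_ofNat_of_zero_le (show 0 ≤ l.length + q by omega)
      rcases eq_or_ne u [] with rfl | hne
      · simp
      refine (infix_iff_occAt hne).2 ⟨m, fun n hn => ?_⟩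
      rw [hi _ (by omega), List.getElem?_eq_getElem hn, show u[n] = _ from (hq n hn).symm]
      congr 2
      push_cast
      rw [show (m : ℤ) = l.length + q by omega]
      ring
  choose x hxF hxv hxu using h'
  let U : Ultrafilter ℕ := hyperfilter ℕ
  have hz : ∀ j : ℤ, ∃ a : A, ∀ᶠ k in U, x k j = a := by
    intro j
    obtain ⟨a, ha⟩ := Ultrafilter.eq_pure_of_finite (U.map fun k => x k j)
    refine ⟨a, ?_⟩
    have : {a} ∈ U.map fun k => x k j := by rw [ha]; exact rfl
    exact this
  choose z hz using hz
  have hagree : ∀ S : Finset ℤ, ∀ᶠ k in U, ∀ j ∈ S, x k j = z j := fun S =>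
    (eventually_all_finset S).2 fun j _ => hz j
  have hlarge : ∀ K : ℕ, ∀ᶠ k in U, K ≤ k := fun K =>
    Nat.hyperfilter_le_atTop (eventually_ge_atTop K)
  refine wordIn_iff.2 ⟨z, ⟨?_, ?_⟩, 0, ?_⟩
  · rintro f hf ⟨q, hq⟩
    obtain ⟨k, hk⟩ := (hagree ((Finset.range f.length).image fun n : ℕ => q + n)).exists
    refine hxF k f hf ⟨q, fun n hn => ?_⟩
    rw [← hq n hn, hk _ (Finset.mem_image_of_mem _ (Finset.mem_range.2 hn))]
  · rintro ⟨q, hq⟩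
    obtain ⟨k, hk, hk2⟩ := ((hagree ((Finset.range u.length).image fun n : ℕ => q + n)).and
      (hlarge (q.natAbs + u.length))).exists
    refine hxu k q (by omega) (by omega) fun n hn => ?_
    rw [← hq n hn, hk _ (Finset.mem_image_of_mem _ (Finset.mem_range.2 hn))]
  · intro n hn
    obtain ⟨k, hk⟩ := (hz n).exists
    rw [hxv k n hn, hk, zero_add]

lemma OccAt.of_occAt {g u w : List A} {a i : ℕ} (hg : OccAt g w a) (hu : OccAt u w i)
    (h1 : i ≤ a) (h2 : a + g.length ≤ i + u.length) : OccAt g u (a - i) := by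
  intro k hk
  rw [← hg k hk, ← hu _ (by omega)]
  congr 1
  omega

/-! ### Loops at a fixed word -/

/-- `r` can be read after `s` in `H`, and reading it leads back to `s`. -/
def IsLoop (H : Set (ℤ → A)) (s r : List A) : Prop :=
  wordIn H (s ++ r) ∧ s <:+ s ++ r

lemma IsLoop.nil {H : Set (ℤ → A)} {s : List A} (hs : wordIn H s) : IsLoop H s [] :=
  ⟨by simpa using hs, by simp⟩

lemma IsLoop.append {F : Finset (List A)} {M : ℕ} (hF : ∀ w ∈ F, w.length ≤ M) {s q r : List A}
    (hs : s.length = M) (hq : IsLoop (SFT1 F) s q) (hr : IsLoop (SFT1 F) s r) :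
    IsLoop (SFT1 F) s (q ++ r) := by
  obtain ⟨hq, y, hy⟩ := hq
  obtain ⟨hr, hr'⟩ := hr
  rw [IsLoop, ← List.append_assoc, ← hy]
  refine ⟨wordIn_glue hF hs (hy ▸ hq) hr, ?_⟩
  rw [List.append_assoc]
  exact hr'.trans (List.suffix_append _ _)

lemma IsLoop.suffix {H : Set (ℤ → A)} {s r : List A} (h : IsLoop H s r)
    (hr : s.length ≤ r.length) : s <:+ r :=
  List.suffix_of_suffix_length_le h.2 (List.suffix_append _ _) hr

lemma IsLoop.of_append {H : Set (ℤ → A)} {s u v : List A} (h : wordIn H (u ++ v)) (hu : s <:+ u)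
    (hv : s <:+ v) : IsLoop H s v := by
  obtain ⟨y, rfl⟩ := hu
  exact ⟨wordIn_of_infix ⟨y, [], by simp⟩ h, hv.trans (List.suffix_append _ _)⟩

lemma exists_isLoop_extend [Finite A] {F : Finset (List A)} {M : ℕ}
    (hF : ∀ w ∈ F, w.length ≤ M) (htrans : Transitive1 (SFT1 F)) {s : List A}
    (hs : s.length = M) (hsH : wordIn (SFT1 F) s) :
    ∃ T : ℕ, ∀ c, wordIn (SFT1 F) c →
      ∃ l r : List A, l.length ≤ T ∧ r.length ≤ T ∧ IsLoop (SFT1 F) s (l ++ c ++ r) := by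
  have hl : ∀ d : List A, ∃ t, wordIn (SFT1 F) d → wordIn (SFT1 F) (s ++ t ++ d) := fun d => by
    by_cases hd : wordIn (SFT1 F) d
    · exact (htrans s d hsH hd).imp fun t ht _ => ht
    · exact ⟨[], fun h => absurd h hd⟩
  have hr : ∀ d : List A, ∃ t, wordIn (SFT1 F) d → wordIn (SFT1 F) (d ++ t ++ s) := fun d => by
    by_cases hd : wordIn (SFT1 F) d
    · exact (htrans d s hd hsH).imp fun t ht _ => ht
    · exact ⟨[], fun h => absurd h hd⟩
  choose tl htl using hl
  choose tr htr using hr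
  have hfin := List.finite_length_eq A M
  obtain ⟨T₁, hT₁⟩ := (hfin.image fun d => (tl d).length).bddAbove
  obtain ⟨T₂, hT₂⟩ := (hfin.image fun d => (tr d).length).bddAbove
  refine ⟨T₁ + T₂ + 2 * M, fun c hc => ?_⟩
  obtain ⟨x, y, hx, hy, hxy⟩ := wordIn_extend hc M
  have hxH : wordIn (SFT1 F) x := wordIn_of_infix ⟨[], c ++ y, by simp⟩ hxy
  have hyH : wordIn (SFT1 F) y := wordIn_of_infix ⟨x ++ c, [], by simp⟩ hxy
  have h1 : (tl x).length ≤ T₁ := hT₁ ⟨x, hx, rfl⟩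
  have h2 : (tr y).length ≤ T₂ := hT₂ ⟨y, hy, rfl⟩
  refine ⟨tl x ++ x, y ++ tr y ++ s, by simp only [List.length_append]; omega,
    by simp only [List.length_append]; omega, ?_, ?_⟩
  · have e1 := wordIn_glue hF (b := c ++ y) hx (htl x hxH) (by simpa using hxy)
    have e2 := wordIn_glue hF (a := s ++ tl x ++ x ++ c) (b := tr y ++ s) hy (by simpa using e1)
      (by simpa using htr y hyH)
    simpa using e2
  · exact ⟨s ++ tl x ++ x ++ c ++ y ++ tr y, by simp⟩

/-- Lengths in a set of words closed under concatenation eventually exhaust the multiples of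
their greatest common divisor. -/
lemma exists_length_eq {P : List A → Prop} (h0 : P []) (happ : ∀ v w, P v → P w → P (v ++ w)) :
    ∃ N : ℕ, ∀ m ≥ N, Nat.setGcd {n | ∃ w, P w ∧ w.length = n} ∣ m →
      ∃ w, P w ∧ w.length = m := by
  obtain ⟨N, hN⟩ := Nat.exists_mem_closure_of_ge {n | ∃ w, P w ∧ w.length = n}
  refine ⟨N, fun m hm hd => ?_⟩
  have hS : AddSubmonoid.closure {n | ∃ w, P w ∧ w.length = n} ≤
      { carrier := {n | ∃ w, P w ∧ w.length = n}
        zero_mem' := ⟨[], h0, rfl⟩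
        add_mem' := by
          rintro _ _ ⟨v, hv, rfl⟩ ⟨w, hw, rfl⟩
          exact ⟨_, happ v w hv hw, by simp⟩ } :=
    AddSubmonoid.closure_le.2 fun _ h => h
  exact hS (hN m hm hd)

/-- The greatest common divisor of the lengths of the loops at `s`. -/
noncomputable def period (H : Set (ℤ → A)) (s : List A) : ℕ :=
  Nat.setGcd {n | ∃ w, IsLoop H s w ∧ w.length = n}

lemma period_dvd {H : Set (ℤ → A)} {s r : List A} (h : IsLoop H s r) : period H s ∣ r.length :=
  Nat.setGcd_dvd_of_mem ⟨r, h, rfl⟩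

lemma exists_isLoop_of_length [Finite A] {F : Finset (List A)} {M : ℕ}
    (hF : ∀ w ∈ F, w.length ≤ M) (htrans : Transitive1 (SFT1 F)) {s : List A}
    (hs : s.length = M) (hsH : wordIn (SFT1 F) s) :
    ∃ K T : ℕ, ∀ c, wordIn (SFT1 F) c → ∀ m, period (SFT1 F) s ∣ m → c.length + K ≤ m →
      ∃ r, r.length = m ∧ IsLoop (SFT1 F) s r ∧ ∃ i ≤ T, (r.drop i).take c.length = c := by
  obtain ⟨T, hT⟩ := exists_isLoop_extend hF htrans hs hsH
  obtain ⟨N, hN⟩ := exists_length_eq (P := IsLoop (SFT1 F) s) (.nil hsH)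
    fun v w hv hw => hv.append hF hs hw
  refine ⟨2 * T + N, T, fun c hc m hm hcm => ?_⟩
  obtain ⟨l, r, hl, hr, hlr⟩ := hT c hc
  have hlen : (l ++ c ++ r).length = l.length + c.length + r.length := by
    simp only [List.length_append]
  obtain ⟨f, hf, hfl⟩ := hN (m - (l ++ c ++ r).length) (by omega)
    ((Nat.dvd_sub hm (period_dvd hlr)))
  refine ⟨l ++ c ++ r ++ f, ?_, hlr.append hF hs hf, l.length, hl, ?_⟩
  · rw [List.length_append, hfl]
    omega
  · simp

/-! ### Concatenations of words from a set -/

/-- Finite concatenations of words from `G`. -/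
inductive Gen (G : Set (List A)) : List A → Prop
  | nil : Gen G []
  | append_left {g q : List A} : g ∈ G → Gen G q → Gen G (g ++ q)

lemma Gen.append {G : Set (List A)} {v w : List A} (hv : Gen G v) (hw : Gen G w) :
    Gen G (v ++ w) := by
  induction hv with
  | nil => exact hw
  | append_left hg _ ih => rw [List.append_assoc]; exact .append_left hg ih

lemma Gen.of_mem {G : Set (List A)} {g : List A} (hg : g ∈ G) : Gen G g := by
  simpa using Gen.append_left hg .nil

lemma Gen.flatten {G : Set (List A)} {L : List (List A)} (h : ∀ v ∈ L, Gen G v) :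
    Gen G L.flatten := by
  induction L with
  | nil => exact .nil
  | cons a L ih =>
    rw [List.flatten_cons]
    exact (h a (by simp)).append (ih fun v hv => h v (by simp [hv]))

lemma Gen.isLoop {F : Finset (List A)} {M : ℕ} (hF : ∀ w ∈ F, w.length ≤ M) {s : List A}
    (hs : s.length = M) (hsH : wordIn (SFT1 F) s) {G : Set (List A)}
    (hG : ∀ g ∈ G, IsLoop (SFT1 F) s g) {w : List A} (hw : Gen G w) :
    IsLoop (SFT1 F) s w := by
  induction hw with
  | nil => exact .nil hsH
  | append_left hg _ ih => exact (hG _ hg).append hF hs ih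

/-- A long word occurring in a concatenation of short words contains one of them. -/
lemma Gen.exists_occAt {G : Set (List A)} {B : ℕ} (hG : ∀ g ∈ G, g.length ≤ B) {u : List A}
    (hu : u ≠ []) (huB : 2 * B ≤ u.length) {w : List A} (hw : Gen G w) {i : ℕ}
    (hi : OccAt u w i) : ∃ g ∈ G, ∃ j < B, OccAt g u j := by
  have hupos := List.length_pos_iff.2 hu
  induction hw generalizing i with
  | nil =>
    have := hi.add_length_le hu
    simp only [List.length_nil] at this
    omega
  | @append_left g q hg hq ih =>
    have hgB := hG g hg
    rcases le_or_gt g.length i with h | h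
    · obtain ⟨j, rfl⟩ := Nat.exists_eq_add_of_le h
      exact ih (occAt_append_left.1 hi)
    rcases Nat.eq_zero_or_pos i with rfl | hpos
    · have h0 : OccAt g (g ++ q) 0 := by simpa using occAt_self [] g q
      exact ⟨g, hg, 0, by omega, by simpa using h0.of_occAt hi (by omega) (by omega)⟩
    · cases hq with
      | nil =>
        have := hi.add_length_le hu
        simp only [List.length_append, List.length_nil] at this
        omega
      | @append_left g' q' hg' hq' =>
        have := hG g' hg'
        have h1 : OccAt g' (g ++ (g' ++ q')) g.length := by
          simpa using occAt_self g g' q'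
        exact ⟨g', hg', g.length - i, by omega, h1.of_occAt hi (by omega) (by omega)⟩

/-! ### Counting words -/

/-- The number of words of length `n` satisfying `P`. -/
noncomputable def count (P : List A → Prop) (n : ℕ) : ℕ :=
  Set.ncard {w : List A | w.length = n ∧ P w}

lemma finite_words [Finite A] (P : List A → Prop) (n : ℕ) :
    {w : List A | w.length = n ∧ P w}.Finite :=
  (List.finite_length_eq A n).subset fun _ h => h.1

lemma count_mono [Finite A] {P Q : List A → Prop} {n : ℕ} (h : ∀ w, w.length = n → P w → Q w) :
    count P n ≤ count Q n :=
  Set.ncard_le_ncard (fun w hw => ⟨hw.1, h w hw.1 hw.2⟩) (finite_words Q n)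

lemma count_le_of_factor [Finite A] {P Q : List A → Prop} {n m T : ℕ}
    (h : ∀ c, c.length = n → P c →
      ∃ r, r.length = m ∧ Q r ∧ ∃ i ≤ T, (r.drop i).take n = c) :
    count P n ≤ (T + 1) * count Q m := by
  have hfin := ((Set.finite_Iic T).prod (finite_words Q m))
  calc count P n ≤ ((fun p : ℕ × List A => (p.2.drop p.1).take n) ''
        (Set.Iic T ×ˢ {w | w.length = m ∧ Q w})).ncard := by
        refine Set.ncard_le_ncard ?_ (hfin.image _)
        rintro c ⟨hc, hP⟩
        obtain ⟨r, hr, hQ, i, hi, hic⟩ := h c hc hP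
        exact ⟨(i, r), ⟨hi, hr, hQ⟩, hic⟩
    _ ≤ (Set.Iic T ×ˢ {w | w.length = m ∧ Q w}).ncard := Set.ncard_image_le hfin
    _ = _ := by
        rw [Set.ncard_prod, Set.ncard_eq_toFinset_card', count]
        simp

lemma count_add_le [Finite A] {P Q R : List A → Prop} {a b : ℕ}
    (h : ∀ v w, v.length = a → w.length = b → P (v ++ w) → Q v ∧ R w) :
    count P (a + b) ≤ count Q a * count R b := by
  rw [count, count, count, ← Set.ncard_prod]
  refine Set.ncard_le_ncard_of_injOn (fun w => (w.take a, w.drop a)) ?_ ?_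
    ((finite_words Q a).prod (finite_words R b))
  · rintro w ⟨hw, hP⟩
    have h1 : (w.take a).length = a := by rw [List.length_take]; omega
    have h2 : (w.drop a).length = b := by rw [List.length_drop]; omega
    obtain ⟨hQ, hR⟩ := h _ _ h1 h2 (by rwa [List.take_append_drop])
    exact ⟨⟨h1, hQ⟩, h2, hR⟩
  · intro v _ w _ hvw
    simp only [Prod.mk.injEq] at hvw
    rw [← List.take_append_drop a v, hvw.1, hvw.2, List.take_append_drop]

lemma count_mul_le [Finite A] {P : List A → Prop} (h : ∀ v w, P (v ++ w) → P v ∧ P w)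
    (k m : ℕ) : count P (k * m) ≤ count P m ^ k := by
  induction k with
  | zero =>
    rw [zero_mul, pow_zero]
    refine (Set.ncard_le_ncard (t := {[]}) ?_).trans (Set.ncard_singleton _).le
    rintro w ⟨hw, -⟩
    exact List.length_eq_zero_iff.1 hw
  | succ k ih =>
    rw [Nat.succ_mul, pow_succ]
    exact (count_add_le fun v w _ _ hvw => h v w hvw).trans (Nat.mul_le_mul_right _ ih)

lemma pow_le_count_gen [Finite A] {G : Set (List A)} {n : ℕ} (hG : ∀ g ∈ G, g.length = n)
    (k : ℕ) : G.ncard ^ k ≤ count (Gen G) (k * n) := by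
  induction k with
  | zero =>
    rw [zero_mul, pow_zero, count, Nat.one_le_iff_ne_zero]
    exact Set.ncard_ne_zero_of_mem (a := []) ⟨rfl, .nil⟩ (finite_words _ _)
  | succ k ih =>
    rw [pow_succ, mul_comm]
    refine (Nat.mul_le_mul_left _ ih).trans ?_
    rw [count, count, ← Set.ncard_prod]
    refine Set.ncard_le_ncard_of_injOn (fun p => p.1 ++ p.2) ?_ ?_ (finite_words _ _)
    · rintro ⟨g, w⟩ ⟨hg, hw, hw'⟩
      refine ⟨?_, .append_left hg hw'⟩
      rw [List.length_append, hG g hg, hw]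
      ring
    · rintro ⟨g, w⟩ ⟨hg, -⟩ ⟨g', w'⟩ ⟨hg', -⟩ h
      obtain ⟨h1, h2⟩ := List.append_inj h ((hG g hg).trans (hG g' hg').symm)
      exact Prod.ext h1 h2

/-! ### Entropy -/

lemma logb_natCast_nonneg (n : ℕ) : 0 ≤ Real.logb 2 (n : ℝ) := by
  rcases Nat.eq_zero_or_pos n with rfl | hn
  · simp
  · exact Real.logb_nonneg one_lt_two (by exact_mod_cast hn)

lemma rpow_le_wordCount {H : Set (ℤ → A)} (hpos : 0 < entropy1 H) {n : ℕ} (hn : n ≠ 0) :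
    (2 : ℝ) ^ (entropy1 H * n) ≤ wordCount H n := by
  obtain ⟨k, rfl⟩ := Nat.exists_eq_succ_of_ne_zero hn
  have hk : (0 : ℝ) < (k : ℝ) + 1 := by positivity
  have hle : entropy1 H ≤ Real.logb 2 (wordCount H (k + 1)) / ((k : ℝ) + 1) := by
    refine ciInf_le ⟨0, ?_⟩ k
    rintro _ ⟨j, rfl⟩
    have := logb_natCast_nonneg (wordCount H (j + 1))
    positivity
  rw [le_div_iff₀ hk] at hle
  have hc : 0 < wordCount H (k + 1) := by
    rcases Nat.eq_zero_or_pos (wordCount H (k + 1)) with h0 | h0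
    · rw [h0] at hle
      simp only [Nat.cast_zero, Real.logb_zero] at hle
      nlinarith
    · exact h0
  rw [← Real.le_logb_iff_rpow_le one_lt_two (by exact_mod_cast hc)]
  push_cast
  exact hle

lemma exists_wordIn {H : Set (ℤ → A)} (hpos : 0 < entropy1 H) (n : ℕ) :
    ∃ w, w.length = n ∧ wordIn H w := by
  have h1 : (0 : ℝ) < wordCount H (n + 1) :=
    (Real.rpow_pos_of_pos two_pos _).trans_le (rpow_le_wordCount hpos n.succ_ne_zero)
  have h2 : 0 < wordCount H (n + 1) := by exact_mod_cast h1
  obtain ⟨w, hw, hwH⟩ := Set.nonempty_of_ncard_ne_zero h2.ne'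
  exact ⟨w.take n, by rw [List.length_take]; omega,
    wordIn_of_infix (List.take_prefix n w).isInfix hwH⟩

lemma wordIn_of_append {H : Set (ℤ → A)} {v w : List A} (h : wordIn H (v ++ w)) :
    wordIn H v ∧ wordIn H w :=
  ⟨wordIn_of_infix (List.prefix_append v w).isInfix h,
    wordIn_of_infix (List.suffix_append v w).isInfix h⟩

lemma period_pos [Finite A] {F : Finset (List A)} {M : ℕ}
    (hF : ∀ w ∈ F, w.length ≤ M) (htrans : Transitive1 (SFT1 F)) {s : List A}
    (hs : s.length = M) (hsH : wordIn (SFT1 F) s) (hpos : 0 < entropy1 (SFT1 F)) :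
    0 < period (SFT1 F) s := by
  obtain ⟨c, hc, hcH⟩ := exists_wordIn hpos 1
  obtain ⟨T, hT⟩ := exists_isLoop_extend hF htrans hs hsH
  obtain ⟨l, r, -, -, h⟩ := hT c hcH
  refine Nat.pos_of_dvd_of_pos (period_dvd h) ?_
  simp only [List.length_append]
  omega

lemma eventually_add_rpow_le {e h : ℝ} (he : 0 < e) (hh : h < e) (K T : ℝ) (hT : 0 < T) :
    ∀ᶠ m : ℕ in atTop, T * ((m : ℝ) + 2 ^ (h * m)) ≤ (2 : ℝ) ^ (e * (m - K)) := by
  have h1 : Tendsto (fun m : ℕ => (m : ℝ) * ((2 : ℝ) ^ (-e)) ^ m) atTop (nhds 0) :=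
    tendsto_self_mul_const_pow_of_lt_one (by positivity)
      (Real.rpow_lt_one_of_one_lt_of_neg one_lt_two (by linarith))
  have h2 : Tendsto (fun m : ℕ => ((2 : ℝ) ^ (h - e)) ^ m) atTop (nhds 0) :=
    tendsto_pow_atTop_nhds_zero_of_lt_one (by positivity)
      (Real.rpow_lt_one_of_one_lt_of_neg one_lt_two (by linarith))
  have h3 := h1.add h2
  rw [add_zero] at h3
  have hpos : (0 : ℝ) < 2 ^ (-(e * K)) / T := by positivity
  filter_upwards [h3.eventually_lt_const hpos] with m hm
  rw [lt_div_iff₀ hT, ← Real.rpow_mul_natCast two_pos.le,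
    ← Real.rpow_mul_natCast two_pos.le] at hm
  have hem : (0 : ℝ) < 2 ^ (e * m) := by positivity
  have e1 : (2 : ℝ) ^ (e * (m - K)) = 2 ^ (-(e * K)) * 2 ^ (e * m) := by
    rw [← Real.rpow_add two_pos]
    ring_nf
  have e2 : (2 : ℝ) ^ (h * m) = 2 ^ ((h - e) * m) * 2 ^ (e * m) := by
    rw [← Real.rpow_add two_pos]
    ring_nf
  have e3 : (1 : ℝ) = 2 ^ (-e * m) * 2 ^ (e * m) := by
    rw [← Real.rpow_add two_pos]
    ring_nf
    simp
  rw [e1, e2]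
  calc T * ((m : ℝ) + 2 ^ ((h - e) * m) * 2 ^ (e * m))
      = ((m * 2 ^ (-e * m) + 2 ^ ((h - e) * m)) * T) * 2 ^ (e * m) := by
        linear_combination T * m * e3
    _ ≤ _ := by gcongr

lemma exists_many_loops [Finite A] {F : Finset (List A)} {M : ℕ}
    (hF : ∀ w ∈ F, w.length ≤ M) (htrans : Transitive1 (SFT1 F)) {s : List A}
    (hs : s.length = M) (hsH : wordIn (SFT1 F) s) (hpos : 0 < entropy1 (SFT1 F)) {h : ℝ}
    (hh : h < entropy1 (SFT1 F)) :
    ∃ m : ℕ, 0 < m ∧ (m : ℝ) + 2 ^ (h * m) ≤ count (IsLoop (SFT1 F) s) m := by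
  obtain ⟨K, T, hKT⟩ := exists_isLoop_of_length hF htrans hs hsH
  have hp := period_pos hF htrans hs hsH hpos
  obtain ⟨m₀, hm₀⟩ := eventually_atTop.1
    (eventually_add_rpow_le hpos hh K (T + 1) (by positivity))
  set p := period (SFT1 F) s
  have hm : m₀ + K + 1 ≤ p * (m₀ + K + 1) := Nat.le_mul_of_pos_left _ hp
  set m := p * (m₀ + K + 1) with hmdef
  refine ⟨m, by omega, ?_⟩
  have h1 := hm₀ m (by omega)
  have h2 : (2 : ℝ) ^ (entropy1 (SFT1 F) * (m - K : ℕ)) ≤ wordCount (SFT1 F) (m - K) :=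
    rpow_le_wordCount hpos (by omega)
  have h3 : wordCount (SFT1 F) (m - K) ≤ (T + 1) * count (IsLoop (SFT1 F) s) m := by
    refine count_le_of_factor (P := wordIn (SFT1 F)) fun c hc hcH => ?_
    have := hKT c hcH m ⟨_, hmdef⟩ (by omega)
    rwa [hc] at this
  have h3' : (wordCount (SFT1 F) (m - K) : ℝ) ≤ (T + 1) * count (IsLoop (SFT1 F) s) m := by
    exact_mod_cast h3
  rw [Nat.cast_sub (by omega)] at h2
  exact le_of_mul_le_mul_left (h1.trans (h2.trans h3')) (by positivity)

/-- Removing any sufficiently long word from a transitive SFT of positive entropy causes an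
arbitrarily small loss of entropy. -/
lemma exists_forall_lt_entropy_avoid [Finite A] {F : Finset (List A)} {M : ℕ}
    (hF : ∀ w ∈ F, w.length ≤ M) (htrans : Transitive1 (SFT1 F)) (hpos : 0 < entropy1 (SFT1 F))
    {h : ℝ} (hh : h < entropy1 (SFT1 F)) :
    ∃ n₀ : ℕ, ∀ u : List A, n₀ ≤ u.length → h < entropy1 (avoidWord (SFT1 F) u) := by
  obtain ⟨s, hs, hsH⟩ := exists_wordIn hpos M
  obtain ⟨h', hh', hh'e⟩ := exists_between hh
  obtain ⟨n, hn, hcount⟩ := exists_many_loops hF htrans hs hsH hpos hh'e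
  refine ⟨2 * n, fun u hu => hh'.trans_le ?_⟩
  have hu0 : u ≠ [] := List.length_pos_iff.1 (by omega)
  set X := avoidWord (SFT1 F) u
  let G : Set (List A) := {w | w.length = n ∧ IsLoop (SFT1 F) s w} \
    (fun j => (u.drop j).take n) '' (Set.Iio n)
  have hGlen : ∀ g ∈ G, g.length = n := fun g hg => hg.1.1
  have hGcard : (2 : ℝ) ^ (h' * n) ≤ G.ncard := by
    have h1 : {w | w.length = n ∧ IsLoop (SFT1 F) s w}.ncard -
        ((fun j => (u.drop j).take n) '' (Set.Iio n)).ncard ≤ G.ncard :=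
      Set.le_ncard_sdiff _ _ ((Set.finite_Iio n).image _)
    have h2 : ((fun j => (u.drop j).take n) '' (Set.Iio n)).ncard ≤ n := by
      refine (Set.ncard_image_le (Set.finite_Iio n)).trans ?_
      rw [Set.ncard_eq_toFinset_card']
      simp
    have h3 : count (IsLoop (SFT1 F) s) n ≤ G.ncard + n := by
      rw [count]
      omega
    have h4 : (count (IsLoop (SFT1 F) s) n : ℝ) ≤ G.ncard + n := by exact_mod_cast h3
    linarith
  have hGpos : 0 < G.ncard := by
    have : (0 : ℝ) < G.ncard := (Real.rpow_pos_of_pos two_pos _).trans_le hGcard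
    exact_mod_cast this
  obtain ⟨g₀, hg₀⟩ := Set.nonempty_of_ncard_ne_zero hGpos.ne'
  have hGu : ∀ w, Gen G w → ¬ u <:+: w := by
    intro w hw huw
    obtain ⟨i, hi⟩ := (infix_iff_occAt hu0).1 huw
    obtain ⟨g, hg, j, hj, hgj⟩ := hw.exists_occAt (fun g hg => (hGlen g hg).le) hu0 hu hi
    refine hg.2 ⟨j, hj, ?_⟩
    have := List.prefix_iff_eq_take.1 (occAt_iff_prefix.1 hgj)
    rw [hGlen g hg] at this
    exact this.symm
  have hGX : ∀ w, Gen G w → wordIn X w := by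
    intro w hw
    refine wordIn_avoid_of_forall_extend fun k => ?_
    have hrep : Gen G (List.replicate k g₀).flatten :=
      Gen.flatten fun v hv => by rw [List.eq_of_mem_replicate hv]; exact .of_mem hg₀
    have hlen : k ≤ (List.replicate k g₀).flatten.length := by
      rw [List.length_flatten, List.map_replicate, List.sum_replicate, hGlen g₀ hg₀, smul_eq_mul]
      exact Nat.le_mul_of_pos_right _ hn
    have hall := (hrep.append hw).append hrep
    exact ⟨_, _, hlen, hlen, (wordIn_of_append
      (hall.isLoop hF hs hsH fun g hg => hg.1.2).1).2, hGu _ hall⟩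
  refine le_ciInf fun k => ?_
  rw [le_div_iff₀ (by positivity)]
  have hle : G.ncard ^ (k + 1) ≤ wordCount X (k + 1) ^ n := by
    calc G.ncard ^ (k + 1) ≤ count (Gen G) ((k + 1) * n) := pow_le_count_gen hGlen _
      _ ≤ count (wordIn X) (n * (k + 1)) := by
        rw [mul_comm]
        exact count_mono fun w _ hw => hGX w hw
      _ ≤ _ := count_mul_le (fun v w => wordIn_of_append) _ _
  have hle' : (2 : ℝ) ^ (h' * n * (k + 1 : ℕ)) ≤ (wordCount X (k + 1) : ℝ) ^ n := by
    calc (2 : ℝ) ^ (h' * n * (k + 1 : ℕ)) = (2 ^ (h' * n)) ^ (k + 1) := by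
          rw [Real.rpow_mul_natCast two_pos.le]
      _ ≤ (G.ncard : ℝ) ^ (k + 1) := by gcongr
      _ ≤ _ := by exact_mod_cast hle
  have hn' : (0 : ℝ) < n := by exact_mod_cast hn
  have hlog := (Real.le_logb_iff_rpow_le one_lt_two
    ((Real.rpow_pos_of_pos two_pos _).trans_le hle')).2 hle'
  rw [Real.logb_pow] at hlog
  push_cast at hlog
  refine le_of_mul_le_mul_left ?_ hn'
  linarith

/-! ### Choice of the words -/

/-- There are finitely generated concatenations of loops realizing all large admissible lengths,
not uniquely determined by their length, and missing some word of the language. -/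
lemma exists_generators [Finite A] {F : Finset (List A)} {M : ℕ}
    (hF : ∀ w ∈ F, w.length ≤ M) (htrans : Transitive1 (SFT1 F)) {s : List A}
    (hs : s.length = M) (hsH : wordIn (SFT1 F) s) (hpos : 0 < entropy1 (SFT1 F)) :
    ∃ (G : Set (List A)) (m a a' : List A) (N : ℕ), (∀ g ∈ G, IsLoop (SFT1 F) s g) ∧
      m ≠ [] ∧ wordIn (SFT1 F) m ∧ (∀ q, Gen G q → ¬ m <:+: q) ∧
      Gen G a ∧ Gen G a' ∧ a.length = a'.length ∧ a ≠ a' ∧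
      ∀ n ≥ N, period (SFT1 F) s ∣ n → ∃ q, Gen G q ∧ q.length = n := by
  obtain ⟨n₀, hn₀⟩ := exists_forall_lt_entropy_avoid hF htrans hpos hpos
  obtain ⟨τ, hτ, hτH⟩ := exists_wordIn hpos n₀
  obtain ⟨T, hT⟩ := exists_isLoop_extend hF htrans hs hsH
  obtain ⟨l, r, -, -, hb⟩ := hT τ hτH
  obtain ⟨m₁, hm₁, hcount⟩ := exists_many_loops hF htrans hs hsH hpos hpos
  have hcount' : 1 < {w | w.length = m₁ ∧ IsLoop (SFT1 F) s w}.ncard := by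
    rw [zero_mul, Real.rpow_zero] at hcount
    have : m₁ + 1 ≤ count (IsLoop (SFT1 F) s) m₁ := by exact_mod_cast hcount
    rw [count] at this
    omega
  obtain ⟨f₁, f₂, ⟨hf₁, hf₁L⟩, ⟨hf₂, hf₂L⟩, hne⟩ :=
    (Set.one_lt_ncard_iff (finite_words _ _)).1 hcount'
  obtain ⟨N₁, hN₁⟩ := exists_length_eq (P := IsLoop (SFT1 F) s) (.nil hsH)
    fun v w hv hw => hv.append hF hs hw
  have hp := period_pos hF htrans hs hsH hpos
  set p := period (SFT1 F) s with hpdef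
  have hN₁p : N₁ ≤ p * N₁ := Nat.le_mul_of_pos_left _ hp
  obtain ⟨f₃, hf₃L, hf₃⟩ := hN₁ (p * N₁) hN₁p (Dvd.intro _ rfl)
  obtain ⟨f₄, hf₄L, hf₄⟩ := hN₁ (p * N₁ + p) (by omega) ((Dvd.intro _ rfl).add dvd_rfl)
  set b := l ++ τ ++ r with hbdef
  let G : Set (List A) :=
    {g | ∃ f, IsLoop (SFT1 F) s f ∧ f.length ≤ m₁ + (p * N₁ + p) ∧ b ++ f = g}
  have hG : ∀ f, IsLoop (SFT1 F) s f → f.length ≤ m₁ + (p * N₁ + p) → Gen G (b ++ f) :=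
    fun f h h' => .of_mem ⟨f, h, h', rfl⟩
  obtain ⟨m, hm, hmX⟩ := exists_wordIn (hn₀ τ hτ.ge) (2 * (b.length + (m₁ + (p * N₁ + p))) + 1)
  obtain ⟨hmH, hmτ⟩ := wordIn_avoid hmX
  have hm0 : m ≠ [] := List.length_pos_iff.1 (by omega)
  obtain ⟨N, hN⟩ := exists_length_eq (P := Gen G) .nil fun v w hv hw => hv.append hw
  refine ⟨G, m, b ++ f₁, b ++ f₂, N, ?_, hm0, hmH, ?_, hG f₁ hf₁L (by omega),
    hG f₂ hf₂L (by omega), by simp only [List.length_append]; omega,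
    fun h => hne (List.append_cancel_left h), fun n hn hpn => hN n hn (dvd_trans ?_ hpn)⟩
  · rintro _ ⟨f, hf, -, rfl⟩
    exact hb.append hF hs hf
  · intro q hq hmq
    obtain ⟨i, hi⟩ := (infix_iff_occAt hm0).1 hmq
    obtain ⟨g, ⟨f, -, -, rfl⟩, j, -, hj⟩ := hq.exists_occAt
      (B := b.length + (m₁ + (p * N₁ + p))) (by
        rintro _ ⟨f, -, hf, rfl⟩
        simp only [List.length_append]
        omega) hm0 (by omega) hi
    have h1 : τ <:+: b ++ f := ⟨l, r ++ f, by simp [hbdef]⟩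
    exact hmτ (h1.trans ((occAt_iff_prefix.1 hj).isInfix.trans (List.drop_suffix j m).isInfix))
  · have h3 := Nat.setGcd_dvd_of_mem (s := {n | ∃ w, Gen G w ∧ w.length = n})
      ⟨b ++ f₃, hG f₃ hf₃L (by omega), rfl⟩
    have h4 := Nat.setGcd_dvd_of_mem (s := {n | ∃ w, Gen G w ∧ w.length = n})
      ⟨b ++ f₄, hG f₄ hf₄L (by omega), rfl⟩
    have := Nat.dvd_sub h4 h3
    rwa [List.length_append (as := b), List.length_append (as := b), hf₃, hf₄,
      show b.length + (p * N₁ + p) - (b.length + p * N₁) = p by omega] at this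

lemma exists_marker [Finite A] {F : Finset (List A)} {M : ℕ}
    (hF : ∀ w ∈ F, w.length ≤ M) (htrans : Transitive1 (SFT1 F)) {s : List A}
    (hs : s.length = M) (hsH : wordIn (SFT1 F) s) (hpos : 0 < entropy1 (SFT1 F))
    {G : Set (List A)} {m : List A} {N : ℕ} (hG : ∀ g ∈ G, IsLoop (SFT1 F) s g)
    (hm0 : m ≠ []) (hm : wordIn (SFT1 F) m) (hmG : ∀ q, Gen G q → ¬ m <:+: q)
    (hN : ∀ n ≥ N, period (SFT1 F) s ∣ n → ∃ q, Gen G q ∧ q.length = n) (n₁ : ℕ) :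
    ∃ t, IsLoop (SFT1 F) s t ∧ n₁ ≤ t.length ∧
      ∀ q, Gen G q → ∀ i, OccAt t (t ++ q) i → i = 0 := by
  obtain ⟨T, hT⟩ := exists_isLoop_extend hF htrans hs hsH
  obtain ⟨l, r, -, -, hρ⟩ := hT m hm
  have hp := period_pos hF htrans hs hsH hpos
  have hle : N + m.length + n₁ ≤ period (SFT1 F) s * (N + m.length + n₁) :=
    Nat.le_mul_of_pos_left _ hp
  obtain ⟨g, hg, hgl⟩ := hN (period (SFT1 F) s * (N + m.length + n₁)) (by omega)
    (Dvd.intro _ rfl)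
  set ρ := l ++ m ++ r with hρdef
  obtain ⟨x, y, hxy, hlast⟩ := exists_last_occ hm0 (Z := ρ ++ g)
    ⟨l.length, by simpa [hρdef] using occAt_self l m (r ++ g)⟩
  refine ⟨ρ ++ g, hρ.append hF hs (hg.isLoop hF hs hsH hG), by
    simp only [List.length_append]; omega, fun q hq i hi => ?_⟩
  have hx : OccAt m (ρ ++ g) x.length := by
    rw [hxy]
    exact occAt_self x m y
  have h1 := hx.trans hi
  rcases le_or_gt ρ.length (i + x.length) with h | h
  · obtain ⟨k, hk⟩ := Nat.exists_eq_add_of_le h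
    rw [hk, List.append_assoc] at h1
    exact absurd ((infix_iff_occAt hm0).2 ⟨k, occAt_append_left.1 h1⟩) (hmG _ (hg.append hq))
  · have := hlast _ (h1.of_append (by simp only [List.length_append]; omega))
    omega

/-! ### Paths between two occurrences of the removed word -/

/-- Every word of the language of the subshift avoiding `t ++ a` is contained in a word `v`
of any prescribed large admissible length which avoids `t ++ a` and is a loop up to a final
`t ++ a`. -/
lemma exists_return_word [Finite A] {F : Finset (List A)} {M : ℕ}
    (hF : ∀ w ∈ F, w.length ≤ M) (htrans : Transitive1 (SFT1 F)) {s : List A}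
    (hs : s.length = M) (hsH : wordIn (SFT1 F) s)
    {G : Set (List A)} {t a a' : List A} {N : ℕ} (hG : ∀ g ∈ G, IsLoop (SFT1 F) s g)
    (ha : Gen G a) (ha' : Gen G a') (hlen : a.length = a'.length) (hne : a ≠ a')
    (hN : ∀ n ≥ N, period (SFT1 F) s ∣ n → ∃ q, Gen G q ∧ q.length = n)
    (htL : IsLoop (SFT1 F) s t) (htM : M < t.length)
    (ht : ∀ q, Gen G q → ∀ i, OccAt t (t ++ q) i → i = 0) :
    ∃ K T : ℕ, ∀ c, wordIn (avoidWord (SFT1 F) (t ++ a)) c → ∀ n,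
      period (SFT1 F) s ∣ n → c.length + K ≤ n →
      ∃ v, v.length = n ∧ (¬ t ++ a <:+: v ∧ IsLoop (SFT1 F) s v) ∧
        ∃ i ≤ T, (v.drop i).take c.length = c := by
  obtain ⟨T, hT⟩ := exists_isLoop_extend hF htrans hs hsH
  have ha0 : IsLoop (SFT1 F) s a := ha.isLoop hF hs hsH hG
  set u := t ++ a with hu
  have hu0 : u ≠ [] := List.length_pos_iff.1 (by rw [hu, List.length_append]; omega)
  have ht0 : t ≠ [] := List.length_pos_iff.1 (by omega)
  have huL : IsLoop (SFT1 F) s u := htL.append hF hs ha0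
  have hus : s <:+ u := huL.suffix (by rw [hu, List.length_append]; omega)
  have hts : s <:+ t := htL.suffix (by omega)
  refine ⟨(T + u.length) + (u.length + T) + t.length + a'.length + N, T + u.length,
    fun c hc n hn hcn => ?_⟩
  obtain ⟨c₁, c₃, h₁, h₃, hcX⟩ := wordIn_extend hc u.length
  obtain ⟨hcH, hcu⟩ := wordIn_avoid hcX
  obtain ⟨l, r, hl, hr, hlr⟩ := hT _ hcH
  obtain ⟨x, y, v₁, v₂, hZ, hfirst, hv₁, hv₂⟩ := exists_between_occ hu0 l c₁ c c₃ r h₁ h₃ hcu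
  have hZL : IsLoop (SFT1 F) s (u ++ (l ++ (c₁ ++ c ++ c₃) ++ r) ++ u) :=
    (huL.append hF hs hlr).append hF hs huL
  set v₀ := v₁ ++ c ++ v₂ with hv₀
  have hpath : wordIn (SFT1 F) (u ++ (v₀ ++ t)) := by
    refine wordIn_of_infix ⟨s ++ x, a ++ y, ?_⟩ hZL.1
    have : u ++ (l ++ (c₁ ++ c ++ c₃) ++ r) ++ u = x ++ u ++ v₀ ++ u ++ y := by
      rw [← hZ]
      simp
    rw [this, hu]
    simp
  have hv₀t : IsLoop (SFT1 F) s (v₀ ++ t) :=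
    .of_append hpath hus (hts.trans (List.suffix_append _ _))
  have hv₀len : v₀.length = v₁.length + c.length + v₂.length := by
    rw [hv₀, List.length_append, List.length_append]
  have ha'L : IsLoop (SFT1 F) s a' := ha'.isLoop hF hs hsH hG
  have hvt : (v₀ ++ t ++ a').length = v₀.length + t.length + a'.length := by
    simp only [List.length_append]
  obtain ⟨q, hq, hql⟩ := hN (n - (v₀ ++ t ++ a').length) (by omega)
    (Nat.dvd_sub hn (period_dvd (hv₀t.append hF hs ha'L)))
  have ha'q := ha'.append hq
  refine ⟨v₀ ++ t ++ (a' ++ q), ?_, ⟨?_, hv₀t.append hF hs (ha'q.isLoop hF hs hsH hG)⟩,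
    v₁.length, by omega, ?_⟩
  · rw [← List.append_assoc, List.length_append, hql]
    omega
  · intro hinf
    obtain ⟨i, hi⟩ := (infix_iff_occAt hu0).1 hinf
    have hulen : u.length = t.length + a.length := by rw [hu, List.length_append]
    have htu : OccAt t u 0 := by simpa [hu] using occAt_self [] t a
    have hti : OccAt t (v₀ ++ (t ++ (a' ++ q))) i := by simpa using htu.trans hi
    rcases lt_trichotomy i v₀.length with h | h | h
    · rcases le_or_gt (i + u.length) (v₀ ++ t).length with h2 | h2
      · have h3 := (hi.of_append h2).append_right a
        have := hfirst i (by simpa [hu] using h3)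
        omega
      · have h3 := OccAt.of_occAt (occAt_self v₀ t (a' ++ q)) hi h.le
          (by rw [List.length_append] at h2; omega)
        have := ht a ha _ h3
        omega
    · subst h
      have h3 : OccAt u (t ++ (a' ++ q)) 0 :=
        (occAt_append_left (X := v₀)).1 (by simpa using hi)
      have h4 := occAt_iff_prefix.1 h3
      rw [List.drop_zero, hu, List.prefix_append_right_inj] at h4
      exact hne (List.append_inj (h4.choose_spec.trans rfl) hlen).1
    · obtain ⟨k, rfl⟩ := Nat.exists_eq_add_of_lt h
      rw [Nat.add_assoc] at hti
      have := ht _ ha'q _ (occAt_append_left.1 hti)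
      omega
  · simp [hv₀]

/-! ### Words avoiding `u` and the entropy of the subshift avoiding `u` -/

/-- `v` is a word of the language of `H` in which `u` does not occur. -/
def Avoids (H : Set (ℤ → A)) (u v : List A) : Prop := wordIn H v ∧ ¬ u <:+: v

lemma Avoids.of_infix {H : Set (ℤ → A)} {u v w : List A} (h : Avoids H u w) (hv : v <:+: w) :
    Avoids H u v :=
  ⟨wordIn_of_infix hv h.1, fun hu => h.2 (hu.trans hv)⟩

lemma exists_wordIn_avoid_of_extend [Finite A] (F : Finset (List A)) (u : List A) (m : ℕ) :
    ∃ k, ∀ l v r : List A, l.length = k → v.length = m → r.length = k →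
      Avoids (SFT1 F) u (l ++ v ++ r) → wordIn (avoidWord (SFT1 F) u) v := by
  have h1 : ∀ v : List A, ∃ k : ℕ, ∀ l r : List A, k ≤ l.length → k ≤ r.length →
      Avoids (SFT1 F) u (l ++ v ++ r) → wordIn (avoidWord (SFT1 F) u) v := by
    intro v
    by_contra! hv
    refine (hv 0).choose_spec.choose_spec.2.2.2 (wordIn_avoid_of_forall_extend fun k => ?_)
    obtain ⟨l, r, hl, hr, h, -⟩ := hv k
    exact ⟨l, r, hl, hr, h.1, h.2⟩
  choose f hf using h1
  obtain ⟨k, hk⟩ := ((finite_words (A := A) (fun _ => True) m).image f).bddAbove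
  refine ⟨k, fun l v r hl hv hr h => ?_⟩
  have := hk ⟨v, ⟨hv, trivial⟩, rfl⟩
  exact hf v l r (by omega) (by omega) h

lemma count_avoids_le [Finite A] {F : Finset (List A)} {u : List A} {m k : ℕ}
    (hk : ∀ l v r : List A, l.length = k → v.length = m → r.length = k →
      Avoids (SFT1 F) u (l ++ v ++ r) → wordIn (avoidWord (SFT1 F) u) v) (j : ℕ) :
    count (Avoids (SFT1 F) u) (k + (j * m + k)) ≤ count (Avoids (SFT1 F) u) k *
      (wordCount (avoidWord (SFT1 F) u) m ^ j * count (Avoids (SFT1 F) u) k) := by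
  set Q := Avoids (SFT1 F) u
  let R : List A → Prop := fun w => ∃ l, l.length = k ∧ Q (l ++ w)
  let S : List A → Prop := fun v => ∃ l r, l.length = k ∧ r.length = k ∧ Q (l ++ v ++ r)
  calc count Q (k + (j * m + k)) ≤ count Q k * count R (j * m + k) :=
        count_add_le fun v w hv _ h =>
          ⟨h.of_infix (List.prefix_append v w).isInfix, v, hv, h⟩
    _ ≤ count Q k * (count S (j * m) * count Q k) := by
        refine Nat.mul_le_mul_left _ (count_add_le ?_)
        rintro v w - hw ⟨l, hl, h⟩
        rw [← List.append_assoc] at h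
        exact ⟨⟨l, w, hl, hw, h⟩, h.of_infix (List.suffix_append _ w).isInfix⟩
    _ ≤ count Q k * (count S m ^ j * count Q k) := by
        refine Nat.mul_le_mul_left _ (Nat.mul_le_mul_right _ (count_mul_le ?_ j m))
        rintro v w ⟨l, r, hl, hr, h⟩
        refine ⟨⟨l, (w ++ r).take k, hl, by simp; omega, h.of_infix ⟨[], (w ++ r).drop k, ?_⟩⟩,
          ⟨(l ++ v).drop v.length, r, by simp [hl], hr,
            h.of_infix ⟨(l ++ v).take v.length, [], ?_⟩⟩⟩
        · simp
        · rw [List.append_nil, ← List.append_assoc, ← List.append_assoc, List.take_append_drop]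
          simp
    _ ≤ _ := by
        refine Nat.mul_le_mul_left _ (Nat.mul_le_mul_right _ (Nat.pow_le_pow_left ?_ j))
        refine count_mono ?_
        rintro v hv ⟨l, r, hl, hr, h⟩
        exact hk l v r hl hv hr h

lemma eventually_logb_count_avoids_lt [Finite A] {F : Finset (List A)} {u : List A}
    (hpos : 0 < entropy1 (avoidWord (SFT1 F) u)) {L : ℝ}
    (hL : entropy1 (avoidWord (SFT1 F) u) < L) :
    ∀ᶠ n : ℕ in atTop, Real.logb 2 (count (Avoids (SFT1 F) u) n) / n < L := by
  set X := avoidWord (SFT1 F) u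
  set Q := Avoids (SFT1 F) u
  have hXQ : ∀ v, wordIn X v → Q v := fun v hv => wordIn_avoid hv
  have hcount : ∀ n, (0 : ℝ) < count Q n := by
    intro n
    obtain ⟨w, hw, hwX⟩ := exists_wordIn hpos n
    have : 0 < count Q n :=
      Nat.pos_of_ne_zero (Set.ncard_ne_zero_of_mem (a := w) ⟨hw, hXQ w hwX⟩ (finite_words _ _))
    exact_mod_cast this
  have hsub : Subadditive fun n => Real.logb 2 (count Q n) := by
    intro a b
    rw [← Real.logb_mul (hcount a).ne' (hcount b).ne']
    refine Real.logb_le_logb_of_le one_lt_two (hcount _) ?_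
    exact_mod_cast count_add_le (P := Q) fun v w _ _ h =>
      ⟨h.of_infix (List.prefix_append v w).isInfix, h.of_infix (List.suffix_append v w).isInfix⟩
  obtain ⟨m, hm⟩ := exists_lt_of_ciInf_lt hL
  rw [div_lt_iff₀ (by positivity)] at hm
  obtain ⟨k, hk⟩ := exists_wordIn_avoid_of_extend F u (m + 1)
  have hN : (0 : ℝ) < wordCount X (m + 1) :=
    (Real.rpow_pos_of_pos two_pos _).trans_le (rpow_le_wordCount hpos m.succ_ne_zero)
  obtain ⟨j, hj⟩ := exists_nat_gt
    ((2 * Real.logb 2 (count Q k) - 2 * k * L) /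
      (L * (m + 1) - Real.logb 2 (wordCount X (m + 1))))
  rw [div_lt_iff₀ (by linarith)] at hj
  refine hsub.eventually_div_lt_of_div_lt (n := k + ((j + 1) * (m + 1) + k))
    (by positivity) ?_
  have hle := Real.logb_le_logb_of_le one_lt_two (hcount _)
    (show (count Q (k + ((j + 1) * (m + 1) + k)) : ℝ) ≤
      count Q k * (wordCount X (m + 1) ^ (j + 1) * count Q k) by
        exact_mod_cast count_avoids_le hk (j + 1))
  rw [Real.logb_mul (hcount k).ne' (mul_pos (pow_pos hN _) (hcount k)).ne',
    Real.logb_mul (pow_pos hN _).ne' (hcount k).ne', Real.logb_pow] at hle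
  rw [div_lt_iff₀ (by positivity)]
  refine hle.trans_lt ?_
  push_cast
  nlinarith

/-- A sequence of sets of words avoiding `u` which is large enough has the entropy of the
subshift avoiding `u` as its exponential growth rate. -/
lemma tendsto_logb_count [Finite A] {F : Finset (List A)} {u : List A}
    (hpos : 0 < entropy1 (avoidWord (SFT1 F) u)) {R : List A → Prop} {α K T : ℕ} (hα : 0 < α)
    (hR : ∀ v, R v → Avoids (SFT1 F) u v)
    (hlow : ∀ c, wordIn (avoidWord (SFT1 F) u) c → ∀ n, c.length + K ≤ n * α →
      ∃ v, v.length = n * α ∧ R v ∧ ∃ i ≤ T, (v.drop i).take c.length = c) :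
    Tendsto (fun n : ℕ => Real.logb 2 (count R (n * α)) / ((n : ℝ) * (α : ℝ))) atTop
      (nhds (entropy1 (avoidWord (SFT1 F) u))) := by
  set X := avoidWord (SFT1 F) u
  have hmul : Tendsto (fun n : ℕ => n * α) atTop atTop :=
    tendsto_id.atTop_mul_const' hα
  have hmul' : Tendsto (fun n : ℕ => (n : ℝ) * (α : ℝ)) atTop atTop := by
    simpa [Function.comp_def] using tendsto_natCast_atTop_atTop (R := ℝ).comp hmul
  have hbound : ∀ᶠ n : ℕ in atTop,
      (2 : ℝ) ^ (entropy1 X * (n * α - K)) ≤ (T + 1) * count R (n * α) := by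
    filter_upwards [hmul.eventually_gt_atTop K] with n hn
    have h1 : (2 : ℝ) ^ (entropy1 X * (n * α - K : ℕ)) ≤ wordCount X (n * α - K) :=
      rpow_le_wordCount hpos (by omega)
    have h2 : wordCount X (n * α - K) ≤ (T + 1) * count R (n * α) := by
      refine count_le_of_factor (P := wordIn X) fun c hc hcX => ?_
      have := hlow c hcX n (by omega)
      rwa [hc] at this
    rw [Nat.cast_sub hn.le, Nat.cast_mul] at h1
    exact h1.trans (by exact_mod_cast h2)
  have hRpos : ∀ᶠ n : ℕ in atTop, (0 : ℝ) < count R (n * α) := by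
    filter_upwards [hbound] with n hn
    exact pos_of_mul_pos_right ((Real.rpow_pos_of_pos two_pos _).trans_le hn) (by positivity)
  refine tendsto_order.2 ⟨fun l hl => ?_, fun L hL => ?_⟩
  · have hlim := (hmul'.const_mul_atTop (sub_pos.2 hl)).eventually_gt_atTop
      (entropy1 X * K + Real.logb 2 (T + 1))
    filter_upwards [hbound, hRpos, hlim, hmul'.eventually_gt_atTop 0] with n h1 h2 h3 h4
    rw [lt_div_iff₀ h4]
    rw [← Real.le_logb_iff_rpow_le one_lt_two (by positivity),
      Real.logb_mul (by positivity) h2.ne'] at h1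
    nlinarith
  · filter_upwards [hmul.eventually (eventually_logb_count_avoids_lt hpos hL), hRpos] with n h1 h2
    rw [Nat.cast_mul] at h1
    refine lt_of_le_of_lt ?_ h1
    gcongr
    · exact one_lt_two
    · exact count_mono fun v _ => hR v

end SymbolicWord

/-- as Statement 4, and moreover
`log₂ Ñ_H(nα) / (nα) → h(H_u)` where `Ñ_H(n)` counts length-`n` words `v` avoiding `u`
with `w₁·v·u ∈ L_H`. -/
theorem stmt6 {A : Type*} [Fintype A] (H : Set (ℤ → A)) (M : ℕ)
    (hH : ∃ F : Finset (List A), (∀ w ∈ F, w.length ≤ M) ∧ H = SFT1 F)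
    (htrans : Transitive1 H) (hpos : 0 < entropy1 H)
    (h : ℝ) (hh : h < entropy1 H) :
    ∃ (α : ℕ) (u w₁ w₂ s : List A), M < α ∧
      u.length = α ∧ w₁.length = α ∧ w₂.length = α ∧
      s.length = M ∧ wordIn H s ∧
      wordIn H (s ++ u) ∧ wordIn H (s ++ w₁) ∧ wordIn H (s ++ w₂) ∧
      s <:+ (s ++ u) ∧ s <:+ (s ++ w₁) ∧ s <:+ (s ++ w₂) ∧
      (∀ w : List A, IsConcat w₁ w₂ w → wordIn H (u ++ w ++ w₁)) ∧
      (∀ w : List A, IsConcat w₁ w₂ w →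
        ∀ i : ℕ, u <+: (u ++ w ++ w₁).drop i → i = 0) ∧
      h < entropy1 (avoidWord H u) ∧
      Tendsto (fun n : ℕ =>
          Real.logb 2
            (Set.ncard {v : List A | v.length = n * α ∧ ¬ u <:+: v ∧
              wordIn H (w₁ ++ v ++ u)}) / ((n : ℝ) * (α : ℝ)))
        atTop (nhds (entropy1 (avoidWord H u))) := by
  open SymbolicWord in
  obtain ⟨F, hF, rfl⟩ := hH
  obtain ⟨s, hs, hsH⟩ := exists_wordIn hpos M
  obtain ⟨n₀, hn₀⟩ := exists_forall_lt_entropy_avoid hF htrans hpos (max_lt hh hpos)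
  obtain ⟨G, m, a, a', N, hG, hm0, hm, hmG, ha, ha', hlen, hne, hN⟩ :=
    exists_generators hF htrans hs hsH hpos
  obtain ⟨t, htL, htlen, ht⟩ :=
    exists_marker hF htrans hs hsH hpos hG hm0 hm hmG hN (M + 1 + n₀ + N)
  obtain ⟨K, T, hKT⟩ := exists_return_word hF htrans hs hsH hG ha ha' hlen hne hN htL
    (by omega) ht
  set u := t ++ a with hu
  have hut : t.length ≤ u.length := by rw [hu, List.length_append]; omega
  have huL : IsLoop (SFT1 F) s u := htL.append hF hs (ha.isLoop hF hs hsH hG)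
  have hper := period_dvd huL
  obtain ⟨w, hw, hwl⟩ := hN u.length (by omega) hper
  have hwL := hw.isLoop hF hs hsH hG
  have hconcat : ∀ v, IsConcat w w v → Gen G (v ++ w) := by
    rintro _ ⟨L, hL, rfl⟩
    exact (Gen.flatten fun v hv => by rcases hL v hv with rfl | rfl <;> exact hw).append hw
  obtain ⟨hhu, hposu⟩ := max_lt_iff.1 (hn₀ u (by omega))
  refine ⟨u.length, u, w, w, s, by omega, rfl, hwl, hwl, hs, hsH, huL.1, hwL.1, hwL.1,
    huL.2, hwL.2, hwL.2, fun v hv => ?_, fun v hv i hi => ?_, hhu, ?_⟩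
  · rw [List.append_assoc]
    exact (wordIn_of_append
      (huL.append hF hs ((hconcat v hv).isLoop hF hs hsH hG)).1).2
  · refine ht (a ++ (v ++ w)) (ha.append (hconcat v hv)) i (occAt_iff_prefix.2 ?_)
    have : t ++ (a ++ (v ++ w)) = u ++ v ++ w := by simp [hu]
    rw [this]
    exact (List.prefix_append t a).trans hi
  · refine tendsto_logb_count hposu (R := fun v => ¬ u <:+: v ∧ wordIn (SFT1 F) (w ++ v ++ u))
      (K := K) (T := T) (by omega) (fun v hv => ⟨wordIn_of_infix ⟨w, u, rfl⟩ hv.2, hv.1⟩)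
      fun c hc n hn => ?_
    obtain ⟨v, hv, ⟨hvu, hvL⟩, hvc⟩ := hKT c hc _ (hper.mul_left n) hn
    exact ⟨v, hv, ⟨hvu, (wordIn_of_append
      ((hwL.append hF hs hvL).append hF hs huL).1).2⟩, hvc⟩
end
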